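/- For every ε > 0 there exists an integer ℓ₀ such that for every odd integer ℓ ≥ ℓ₀, the dimension δ_ℓ of the ℚ-vector space spanned by 1, ζ(3), ζ(5), …, ζ(ℓ) satisfies δ_ℓ ≥ ((1−ε)/(1+log 2))·log ℓ. -/

import Mathlib

/-- The values of the Riemann zeta function at integers `s ≥ 2`,
as a real number: `ζ(s) = ∑_{n ≥ 1} n^{-s}`. -/
noncomputable def zetaR (s : ℕ) : ℝ := ∑' n : ℕ, 1 / (n + 1 : ℝ) ^ s

/-- `δ_ℓ`: the dimension of the ℚ-vector subspace of ℝ spanned by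
`1, ζ(3), ζ(5), …, ζ(ℓ)` (odd arguments `3 ≤ s ≤ ℓ`). -/
noncomputable def deltaDim (ℓ : ℕ) : ℕ :=
  Module.finrank ℚ
    (Submodule.span ℚ
      (({1} : Set ℝ) ∪ {x : ℝ | ∃ s : ℕ, Odd s ∧ 3 ≤ s ∧ s ≤ ℓ ∧ x = zetaR s}))

open Filter Topology MeasureTheory

/-- The Fejér kernel `v ↦ 2 (1 - cos v) / v ^ 2`. -/
noncomputable def fejerKernel (v : ℝ) : ℝ := if v = 0 then 1 else 2 * (1 - Real.cos v) / v ^ 2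

lemma fejerKernel_nonneg (v : ℝ) : 0 ≤ fejerKernel v := by
  unfold fejerKernel
  split_ifs
  · exact zero_le_one
  · have := Real.cos_le_one v
    exact div_nonneg (by linarith) (sq_nonneg v)

lemma integral_fejer_neg {v : ℝ} (hv : v ≠ 0) :
    ∫ τ : ℝ in (-1)..0, ((1 - |τ| : ℝ) : ℂ) * Complex.exp (τ * v * Complex.I) =
      1 / (v * Complex.I) - 1 / (v * Complex.I) ^ 2
        + Complex.exp (-(v * Complex.I)) / (v * Complex.I) ^ 2 := by
  have hv' : (v : ℂ) ≠ 0 := by simp [hv]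
  have h1 : ∫ τ : ℝ in (-1)..0, ((1 - |τ| : ℝ) : ℂ) * Complex.exp (τ * v * Complex.I) =
      ∫ τ : ℝ in (-1)..0, ((1 : ℂ) + τ) * Complex.exp (τ * (v * Complex.I)) := by
    refine intervalIntegral.integral_congr fun τ hτ ↦ ?_
    rw [Set.uIcc_of_le (by norm_num)] at hτ
    simp only [abs_of_nonpos hτ.2, mul_assoc]
    push_cast
    ring
  have h2 (τ : ℝ) : HasDerivAt
      (fun τ : ℝ ↦ ((1 : ℂ) + τ) * Complex.exp (τ * (v * Complex.I)) / (v * Complex.I)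
        - Complex.exp (τ * (v * Complex.I)) / (v * Complex.I) ^ 2)
      (((1 : ℂ) + τ) * Complex.exp (τ * (v * Complex.I))) τ := by
    have hid : HasDerivAt (fun τ : ℝ ↦ (τ : ℂ)) 1 τ := Complex.ofRealCLM.hasDerivAt
    have he := (hid.mul_const (v * Complex.I : ℂ)).cexp
    convert! (((hid.const_add 1).mul he).div_const (v * Complex.I)).sub
      (he.div_const ((v * Complex.I) ^ 2)) using 1
    field_simp
    ring
  rw [h1, intervalIntegral.integral_eq_sub_of_hasDerivAt (fun τ _ ↦ h2 τ)
    (Continuous.intervalIntegrable (by fun_prop) _ _)]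
  simp

lemma integral_fejer_pos {v : ℝ} (hv : v ≠ 0) :
    ∫ τ : ℝ in (0)..1, ((1 - |τ| : ℝ) : ℂ) * Complex.exp (τ * v * Complex.I) =
      Complex.exp (v * Complex.I) / (v * Complex.I) ^ 2
        - 1 / (v * Complex.I) - 1 / (v * Complex.I) ^ 2 := by
  have hv' : (v : ℂ) ≠ 0 := by simp [hv]
  have h1 : ∫ τ : ℝ in (0)..1, ((1 - |τ| : ℝ) : ℂ) * Complex.exp (τ * v * Complex.I) =
      ∫ τ : ℝ in (0)..1, ((1 : ℂ) - τ) * Complex.exp (τ * (v * Complex.I)) := by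
    refine intervalIntegral.integral_congr fun τ hτ ↦ ?_
    rw [Set.uIcc_of_le (by norm_num)] at hτ
    simp only [abs_of_nonneg hτ.1, mul_assoc]
    push_cast
    ring
  have h2 (τ : ℝ) : HasDerivAt
      (fun τ : ℝ ↦ ((1 : ℂ) - τ) * Complex.exp (τ * (v * Complex.I)) / (v * Complex.I)
        + Complex.exp (τ * (v * Complex.I)) / (v * Complex.I) ^ 2)
      (((1 : ℂ) - τ) * Complex.exp (τ * (v * Complex.I))) τ := by
    have hid : HasDerivAt (fun τ : ℝ ↦ (τ : ℂ)) 1 τ := Complex.ofRealCLM.hasDerivAt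
    have he := (hid.mul_const (v * Complex.I : ℂ)).cexp
    convert! (((hid.const_sub 1).mul he).div_const (v * Complex.I)).add
      (he.div_const ((v * Complex.I) ^ 2)) using 1
    field_simp
    ring
  rw [h1, intervalIntegral.integral_eq_sub_of_hasDerivAt (fun τ _ ↦ h2 τ)
    (Continuous.intervalIntegrable (by fun_prop) _ _)]
  simp
  ring

/-- The Fejér kernel is the Fourier transform of the triangle function. -/
lemma integral_fejer (v : ℝ) :
    ∫ τ : ℝ in (-1)..1, ((1 - |τ| : ℝ) : ℂ) * Complex.exp (τ * v * Complex.I) =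
      (fejerKernel v : ℂ) := by
  have hInt (a b : ℝ) : IntervalIntegrable
      (fun τ : ℝ ↦ ((1 - |τ| : ℝ) : ℂ) * Complex.exp (τ * v * Complex.I)) volume a b :=
    Continuous.intervalIntegrable (by fun_prop) _ _
  rw [← intervalIntegral.integral_add_adjacent_intervals (hInt (-1) 0) (hInt 0 1)]
  rcases eq_or_ne v 0 with rfl | hv
  · have e1 : ∫ τ : ℝ in (-1)..0, (1 - |τ|) = 1 / 2 := by
      have : ∫ τ : ℝ in (-1)..0, (1 - |τ|) = ∫ τ : ℝ in (-1)..0, (1 + τ) := by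
        refine intervalIntegral.integral_congr fun τ hτ ↦ ?_
        rw [Set.uIcc_of_le (by norm_num)] at hτ
        simp only [abs_of_nonpos hτ.2]
        ring
      rw [this, intervalIntegral.integral_add (by simp) (by simp)]
      norm_num
    have e2 : ∫ τ : ℝ in (0)..1, (1 - |τ|) = 1 / 2 := by
      have : ∫ τ : ℝ in (0)..1, (1 - |τ|) = ∫ τ : ℝ in (0)..1, (1 - τ) := by
        refine intervalIntegral.integral_congr fun τ hτ ↦ ?_
        rw [Set.uIcc_of_le (by norm_num)] at hτ
        simp only [abs_of_nonneg hτ.1]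
      rw [this, intervalIntegral.integral_sub (by simp) (by simp)]
      norm_num
    simp only [Complex.ofReal_zero, mul_zero, zero_mul, Complex.exp_zero, mul_one, fejerKernel,
      if_true]
    rw [intervalIntegral.integral_ofReal, intervalIntegral.integral_ofReal, e1, e2]
    norm_num
  · rw [integral_fejer_neg hv, integral_fejer_pos hv, fejerKernel, if_neg hv]
    have hv' : (v : ℂ) ≠ 0 := by simp [hv]
    push_cast
    have hcos := Complex.two_cos v
    have : Complex.exp (-(v * Complex.I)) = 2 * Complex.cos v - Complex.exp (v * Complex.I) := by
      rw [hcos]; simp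
    rw [this]
    have hI := Complex.I_sq
    field_simp
    rw [hI]
    ring

lemma continuous_fejerKernel : Continuous fejerKernel := by
  have h : Continuous fun v : ℝ ↦
      ∫ τ : ℝ in (-1)..1, ((1 - |τ| : ℝ) : ℂ) * Complex.exp (τ * v * Complex.I) :=
    intervalIntegral.continuous_parametric_intervalIntegral_of_continuous' (by fun_prop) _ _
  simp_rw [integral_fejer] at h
  exact Complex.continuous_re.comp h

lemma fejerKernel_le (v : ℝ) : fejerKernel v ≤ 5 * (1 + v ^ 2)⁻¹ := by
  have hpos : (0 : ℝ) < 1 + v ^ 2 := by positivity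
  unfold fejerKernel
  split_ifs with h
  · norm_num [h]
  · have hv : 0 < v ^ 2 := by positivity
    rw [← div_eq_mul_inv, div_le_div_iff₀ hv hpos]
    have h1 := Real.one_sub_sq_div_two_le_cos (x := v)
    have h2 := Real.neg_one_le_cos v
    nlinarith

lemma integrable_fejerKernel : Integrable fejerKernel :=
  (integrable_inv_one_add_sq.const_mul 5).mono' continuous_fejerKernel.aestronglyMeasurable
    (.of_forall fun v ↦ by
      rw [Real.norm_of_nonneg (fejerKernel_nonneg v)]; exact fejerKernel_le v)

lemma integral_fejerKernel_pos : 0 < ∫ v, fejerKernel v := by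
  refine integral_pos_of_integrable_nonneg_nonzero (x := 0) continuous_fejerKernel
    integrable_fejerKernel fejerKernel_nonneg ?_
  simp [fejerKernel]

/-- `y ↦ ψ(e ^ y) / e ^ y`, with `ψ` the second Chebyshev function. -/
noncomputable def psiExp (y : ℝ) : ℝ := Chebyshev.psi (Real.exp y) * Real.exp (-y)

lemma psiExp_nonneg (y : ℝ) : 0 ≤ psiExp y :=
  mul_nonneg (Chebyshev.psi_nonneg _) (Real.exp_pos _).le

lemma psiExp_le (y : ℝ) : psiExp y ≤ Real.log 4 + 4 := by
  have h := Chebyshev.psi_le_const_mul_self (Real.exp_pos y).le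
  calc psiExp y ≤ (Real.log 4 + 4) * Real.exp y * Real.exp (-y) := by unfold psiExp; gcongr
    _ = Real.log 4 + 4 := by rw [mul_assoc, ← Real.exp_add]; simp

lemma measurable_psiExp : Measurable psiExp :=
  (Chebyshev.psi_mono.measurable.comp Real.measurable_exp).mul
    (Real.measurable_exp.comp measurable_neg)

lemma psiExp_mul_exp_le {x y : ℝ} (h : x ≤ y) : psiExp x * Real.exp (x - y) ≤ psiExp y := by
  unfold psiExp
  rw [mul_assoc, ← Real.exp_add]
  have : -x + (x - y) = -y := by ring
  rw [this]
  gcongr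

lemma sum_vonMangoldt_eq_psi (t : ℝ) :
    ∑ k ∈ Finset.Icc 1 ⌊t⌋₊, (ArithmeticFunction.vonMangoldt k) = Chebyshev.psi t := rfl

lemma integral_psiExp {s : ℂ} (hs : 1 < s.re) :
    ∫ y in Set.Ioi (0 : ℝ), (psiExp y : ℂ) * Complex.exp (-(s - 1) * y) =
      LSeries (fun n ↦ (ArithmeticFunction.vonMangoldt n : ℂ)) s / s := by
  have hs0 : s ≠ 0 := by rintro rfl; norm_num at hs
  have hO : (fun n : ℕ ↦ ∑ k ∈ Finset.Icc 1 n, ArithmeticFunction.vonMangoldt k)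
      =O[atTop] fun n ↦ (n : ℝ) ^ (1 : ℝ) := by
    refine Asymptotics.IsBigO.of_bound (Real.log 4 + 4) (.of_forall fun n ↦ ?_)
    have h1 := Chebyshev.psi_le_const_mul_self (Nat.cast_nonneg (α := ℝ) n)
    have h2 := Chebyshev.psi_nonneg n
    have h3 : ∑ k ∈ Finset.Icc 1 n, ArithmeticFunction.vonMangoldt k = Chebyshev.psi n := by
      rw [← sum_vonMangoldt_eq_psi, Nat.floor_natCast]
    rw [h3, Real.norm_of_nonneg h2, Real.rpow_one, Real.norm_of_nonneg (Nat.cast_nonneg n)]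
    exact h1
  rw [LSeries_eq_mul_integral_of_nonneg _ zero_le_one hs hO
    fun _ ↦ ArithmeticFunction.vonMangoldt_nonneg, mul_div_cancel_left₀ _ hs0]
  have himg : Set.Ioi (1 : ℝ) = Set.image Real.exp (Set.Ioi 0) := by
    ext t
    refine ⟨fun ht ↦ ⟨Real.log t, Real.log_pos ht, Real.exp_log (zero_lt_one.trans ht)⟩, ?_⟩
    rintro ⟨y, hy, rfl⟩
    exact Real.one_lt_exp_iff.2 hy
  rw [himg, integral_image_eq_integral_abs_deriv_smul measurableSet_Ioi
    (fun x _ ↦ (Real.hasDerivAt_exp x).hasDerivWithinAt) Real.exp_injective.injOn]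
  refine setIntegral_congr_fun measurableSet_Ioi fun y _ ↦ ?_
  rw [← Complex.ofReal_sum, sum_vonMangoldt_eq_psi, abs_of_pos (Real.exp_pos y), psiExp,
    Complex.real_smul, Complex.ofReal_exp, Complex.cpow_def_of_ne_zero (Complex.exp_ne_zero _),
    Complex.log_exp (by simp [Real.pi_pos]) (by simp [Real.pi_pos.le])]
  push_cast
  rw [mul_assoc, ← Complex.exp_add, mul_left_comm, ← Complex.exp_add]
  congr 2
  ring

open ArithmeticFunction.vonMangoldt in
/-- The Laplace transform of `psiExp - 1` extends continuously to the line `re s = 1`. -/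
lemma exists_continuousOn_laplace_psiExp : ∃ Φ : ℂ → ℂ, ContinuousOn Φ {s | 1 ≤ s.re} ∧
    ∀ s : ℂ, 1 < s.re →
      ∫ y in Set.Ioi (0 : ℝ), ((psiExp y - 1 : ℝ) : ℂ) * Complex.exp (-(s - 1) * y) = Φ s := by
  have hs0 (s : ℂ) (hs : 1 ≤ s.re) : s ≠ 0 := by rintro rfl; norm_num at hs
  refine ⟨fun s ↦ (LFunctionResidueClassAux (1 : ZMod 1) s - 1) / s, ?_, fun s hs ↦ ?_⟩
  · exact ((continuousOn_LFunctionResidueClassAux (1 : ZMod 1)).sub continuousOn_const).div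
      continuousOn_id hs0
  · have hs1 : s - 1 ≠ 0 := by
      intro h
      rw [sub_eq_zero] at h
      norm_num [h] at hs
    have hexp : IntegrableOn (fun y : ℝ ↦ Complex.exp (-(s - 1) * y)) (Set.Ioi 0) :=
      integrableOn_exp_mul_complex_Ioi (by simpa using hs) 0
    have hpsi : IntegrableOn (fun y : ℝ ↦ (psiExp y : ℂ) * Complex.exp (-(s - 1) * y))
        (Set.Ioi 0) := by
      refine Integrable.bdd_mul (c := Real.log 4 + 4) hexp
        (Complex.measurable_ofReal.comp measurable_psiExp).aestronglyMeasurable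
        (.of_forall fun y ↦ ?_)
      rw [Complex.norm_real, Real.norm_of_nonneg (psiExp_nonneg y)]
      exact psiExp_le y
    have hL : (fun n ↦ ((residueClass (1 : ZMod 1) n : ℝ) : ℂ)) =
        fun n ↦ (ArithmeticFunction.vonMangoldt n : ℂ) := by
      ext n
      have hn : n ∈ {n : ℕ | (n : ZMod 1) = 1} := Subsingleton.elim (α := ZMod 1) _ _
      rw [residueClass, Set.indicator_of_mem hn]
    simp only [Complex.ofReal_sub, sub_mul, Complex.ofReal_one, one_mul]
    rw [integral_sub hpsi hexp, integral_psiExp hs, integral_exp_mul_complex_Ioi (by simpa using hs),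
      eqOn_LFunctionResidueClassAux isUnit_one hs, hL]
    have hs2 := hs0 s hs.le
    have hs3 : 1 - s ≠ 0 := fun h ↦ hs1 (by linear_combination -h)
    simp
    field_simp
    ring

lemma norm_psiExp_sub_one_le (y : ℝ) : ‖((psiExp y - 1 : ℝ) : ℂ)‖ ≤ Real.log 4 + 5 := by
  rw [Complex.norm_real, Real.norm_eq_abs, abs_le]
  have h1 := psiExp_nonneg y
  have h2 := psiExp_le y
  have h3 : 0 < Real.log 4 := Real.log_pos (by norm_num)
  constructor <;> linarith

lemma measurable_psiExp_sub_one : Measurable fun y ↦ ((psiExp y - 1 : ℝ) : ℂ) :=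
  Complex.measurable_ofReal.comp (measurable_psiExp.sub_const 1)

lemma integral_psiExp_fejer_damped {Φ : ℂ → ℂ}
    (hΦ : ∀ s : ℂ, 1 < s.re →
      ∫ y in Set.Ioi (0 : ℝ), ((psiExp y - 1 : ℝ) : ℂ) * Complex.exp (-(s - 1) * y) = Φ s)
    {η : ℝ} (hη : 0 < η) (c x : ℝ) :
    ∫ y in Set.Ioi (0 : ℝ), ((psiExp y - 1 : ℝ) : ℂ) *
        (Complex.exp (-(η * y)) * (fejerKernel (c * (x - y)) : ℂ)) =
      ∫ τ : ℝ in (-1)..1, ((1 - |τ| : ℝ) : ℂ) * Complex.exp (τ * (c * x) * Complex.I) *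
        Φ (1 + η + τ * c * Complex.I) := by
  have hsw := intervalIntegral_integral_swap (a := (-1 : ℝ)) (b := 1)
    (μ := volume.restrict (Set.Ioi (0 : ℝ)))
    (f := fun (τ y : ℝ) ↦ ((psiExp y - 1 : ℝ) : ℂ) * (Complex.exp (-(η * y)) *
      (((1 - |τ| : ℝ) : ℂ) * Complex.exp (τ * (c * (x - y)) * Complex.I)))) ?_
  · calc _ = ∫ y in Set.Ioi (0 : ℝ), ∫ τ : ℝ in (-1)..1, ((psiExp y - 1 : ℝ) : ℂ) *
        (Complex.exp (-(η * y)) *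
          (((1 - |τ| : ℝ) : ℂ) * Complex.exp (τ * (c * (x - y)) * Complex.I))) := by
          refine integral_congr_ae (.of_forall fun y ↦ ?_)
          simp only
          rw [intervalIntegral.integral_const_mul, intervalIntegral.integral_const_mul,
            ← integral_fejer]
          push_cast
          rfl
      _ = _ := by
          rw [← hsw]
          refine intervalIntegral.integral_congr fun τ _ ↦ ?_
          rw [← hΦ _ (by simpa using hη), ← integral_const_mul]
          refine integral_congr_ae (.of_forall fun y ↦ ?_)
          simp only
          have : Complex.exp (-(η * y)) * Complex.exp (τ * (c * (x - y)) * Complex.I) =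
              Complex.exp (τ * (c * x) * Complex.I) *
                Complex.exp (-(1 + η + τ * c * Complex.I - 1) * y) := by
            rw [← Complex.exp_add, ← Complex.exp_add]
            congr 1
            ring
          linear_combination ((psiExp y - 1 : ℝ) : ℂ) * ((1 - |τ| : ℝ) : ℂ) * this
  · have hbound : Integrable (fun p : ℝ × ℝ ↦ (Real.log 4 + 5) * Real.exp (-η * p.2))
        ((volume.restrict (Set.uIoc (-1 : ℝ) 1)).prod (volume.restrict (Set.Ioi (0 : ℝ)))) :=
      Integrable.mul_prod (f := fun _ ↦ Real.log 4 + 5) (g := fun y ↦ Real.exp (-η * y))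
        (integrableOn_const (by simp)) (integrableOn_exp_mul_Ioi (by linarith) 0)
    refine hbound.mono' (Measurable.aestronglyMeasurable ?_) ?_
    · exact (measurable_psiExp_sub_one.comp measurable_snd).mul
        (Continuous.measurable (by fun_prop))
    · rw [Measure.prod_restrict, ae_restrict_iff' (measurableSet_uIoc.prod measurableSet_Ioi)]
      refine .of_forall fun p hp ↦ ?_
      have hτ := hp.1
      rw [Set.uIoc_of_le (by norm_num)] at hτ
      have h1 : ‖((1 - |p.1| : ℝ) : ℂ)‖ ≤ 1 := by
        rw [Complex.norm_real, Real.norm_eq_abs]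
        have : |p.1| ≤ 1 := abs_le.2 ⟨hτ.1.le, hτ.2⟩
        rw [abs_of_nonneg (by linarith)]
        linarith [abs_nonneg p.1]
      have h2 : ‖Complex.exp (p.1 * (c * (x - p.2)) * Complex.I)‖ = 1 := by
        have := Complex.norm_exp_ofReal_mul_I (p.1 * (c * (x - p.2)))
        push_cast at this
        exact this
      have h3 : ‖Complex.exp (-(η * p.2))‖ = Real.exp (-η * p.2) := by
        rw [Complex.norm_exp]
        simp
      simp only [Function.uncurry]
      rw [norm_mul, norm_mul, norm_mul, h2, h3, mul_one]
      have h4 := norm_psiExp_sub_one_le p.2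
      have h5 := (Real.exp_pos (-η * p.2)).le
      calc _ ≤ (Real.log 4 + 5) * (Real.exp (-η * p.2) * 1) := by gcongr
        _ = _ := by ring

lemma integral_psiExp_fejer {Φ : ℂ → ℂ} (hΦc : ContinuousOn Φ {s | 1 ≤ s.re})
    (hΦ : ∀ s : ℂ, 1 < s.re →
      ∫ y in Set.Ioi (0 : ℝ), ((psiExp y - 1 : ℝ) : ℂ) * Complex.exp (-(s - 1) * y) = Φ s)
    {c : ℝ} (hc : 0 < c) (x : ℝ) :
    ∫ y in Set.Ioi (0 : ℝ), ((psiExp y - 1 : ℝ) : ℂ) * (fejerKernel (c * (x - y)) : ℂ) =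
      ∫ τ : ℝ in (-1)..1, ((1 - |τ| : ℝ) : ℂ) * Complex.exp (τ * (c * x) * Complex.I) *
        Φ (1 + τ * c * Complex.I) := by
  have hker : Integrable fun y ↦ fejerKernel (c * (x - y)) :=
    (integrable_fejerKernel.comp_mul_left' hc.ne').comp_sub_left x
  have hl : Tendsto (fun η : ℝ ↦ ∫ y in Set.Ioi (0 : ℝ), ((psiExp y - 1 : ℝ) : ℂ) *
        (Complex.exp (-(η * y)) * (fejerKernel (c * (x - y)) : ℂ))) (𝓝[>] 0)
      (𝓝 (∫ y in Set.Ioi (0 : ℝ), ((psiExp y - 1 : ℝ) : ℂ) *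
        (fejerKernel (c * (x - y)) : ℂ))) := by
    refine tendsto_integral_filter_of_dominated_convergence
      (fun y ↦ (Real.log 4 + 5) * fejerKernel (c * (x - y))) ?_ ?_ ?_ ?_
    · refine .of_forall fun η ↦ Measurable.aestronglyMeasurable ?_
      refine measurable_psiExp_sub_one.mul (Continuous.measurable ?_)
      have := continuous_fejerKernel
      fun_prop
    · filter_upwards [self_mem_nhdsWithin] with η hη
      rw [ae_restrict_iff' measurableSet_Ioi]
      refine .of_forall fun y hy ↦ ?_
      have h3 : ‖Complex.exp (-(η * y))‖ ≤ 1 := by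
        rw [Complex.norm_exp]
        simpa using mul_nonneg (le_of_lt hη) (le_of_lt hy)
      rw [norm_mul, norm_mul, Complex.norm_real (fejerKernel _),
        Real.norm_of_nonneg (fejerKernel_nonneg _)]
      have h4 := norm_psiExp_sub_one_le y
      have h5 := fejerKernel_nonneg (c * (x - y))
      calc _ ≤ (Real.log 4 + 5) * (1 * fejerKernel (c * (x - y))) := by gcongr
        _ = _ := by ring
    · exact (hker.const_mul _).integrableOn
    · refine .of_forall fun y ↦ ?_
      have : Continuous fun η : ℝ ↦ ((psiExp y - 1 : ℝ) : ℂ) *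
        (Complex.exp (-(η * y)) * (fejerKernel (c * (x - y)) : ℂ)) := by fun_prop
      have h0 := this.tendsto 0
      simp only [Complex.ofReal_zero, zero_mul, neg_zero, Complex.exp_zero, one_mul] at h0
      exact h0.mono_left nhdsWithin_le_nhds
  have hcompact : IsCompact (Set.image (fun p : ℝ × ℝ ↦ (1 + p.1 + p.2 * c * Complex.I : ℂ))
      (Set.Icc (0 : ℝ) 1 ×ˢ Set.Icc (-1 : ℝ) 1)) :=
    (isCompact_Icc.prod isCompact_Icc).image (by fun_prop)
  obtain ⟨M, hM⟩ := hcompact.exists_bound_of_continuousOn (f := Φ) (hΦc.mono (by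
    rintro _ ⟨p, hp, rfl⟩
    simpa using hp.1.1))
  have hr : Tendsto (fun η : ℝ ↦ ∫ τ : ℝ in (-1)..1, ((1 - |τ| : ℝ) : ℂ) *
        Complex.exp (τ * (c * x) * Complex.I) * Φ (1 + η + τ * c * Complex.I)) (𝓝[>] 0)
      (𝓝 (∫ τ : ℝ in (-1)..1, ((1 - |τ| : ℝ) : ℂ) * Complex.exp (τ * (c * x) * Complex.I) *
        Φ (1 + τ * c * Complex.I))) := by
    refine intervalIntegral.tendsto_integral_filter_of_dominated_convergence
      (fun _ ↦ M) ?_ ?_ (by simp) ?_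
    · filter_upwards [self_mem_nhdsWithin] with η hη
      refine Continuous.aestronglyMeasurable ?_
      refine Continuous.mul (by fun_prop) ?_
      refine hΦc.comp_continuous (by fun_prop) fun τ ↦ ?_
      simpa using le_of_lt hη
    · filter_upwards [Ioc_mem_nhdsGT (zero_lt_one' ℝ)] with η hη
      refine .of_forall fun τ hτ ↦ ?_
      rw [Set.uIoc_of_le (by norm_num)] at hτ
      have h1 : ‖((1 - |τ| : ℝ) : ℂ)‖ ≤ 1 := by
        rw [Complex.norm_real, Real.norm_eq_abs]
        have : |τ| ≤ 1 := abs_le.2 ⟨hτ.1.le, hτ.2⟩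
        rw [abs_of_nonneg (by linarith)]
        linarith [abs_nonneg τ]
      have h2 : ‖Complex.exp (τ * (c * x) * Complex.I)‖ = 1 := by
        have := Complex.norm_exp_ofReal_mul_I (τ * (c * x))
        push_cast at this
        exact this
      rw [norm_mul, norm_mul, h2, mul_one]
      have h3 := hM (1 + η + τ * c * Complex.I)
        ⟨(η, τ), ⟨⟨hη.1.le, hη.2⟩, ⟨hτ.1.le, hτ.2⟩⟩, rfl⟩
      calc _ ≤ 1 * M := by gcongr
        _ = M := one_mul M
    · refine .of_forall fun τ _ ↦ Tendsto.const_mul _ ?_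
      have h0 : ContinuousWithinAt Φ {s | 1 ≤ s.re} (1 + τ * c * Complex.I) :=
        hΦc _ (by simp)
      refine h0.tendsto.comp (tendsto_nhdsWithin_iff.2 ⟨?_, ?_⟩)
      · have : Continuous fun η : ℝ ↦ (1 + η + τ * c * Complex.I : ℂ) := by fun_prop
        have h1 := this.tendsto 0
        simp only [Complex.ofReal_zero, add_zero] at h1
        exact h1.mono_left nhdsWithin_le_nhds
      · filter_upwards [self_mem_nhdsWithin] with η hη
        simpa using le_of_lt hη
  refine tendsto_nhds_unique (hl.congr' ?_) hr
  filter_upwards [self_mem_nhdsWithin] with η hη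
  exact integral_psiExp_fejer_damped hΦ hη c x

lemma tendsto_integral_psiExp_fejer {c : ℝ} (hc : 0 < c) :
    Tendsto (fun x ↦ ∫ y in Set.Ioi (0 : ℝ), (psiExp y - 1) * fejerKernel (c * (x - y)))
      atTop (𝓝 0) := by
  obtain ⟨Φ, hΦc, hΦ⟩ := exists_continuousOn_laplace_psiExp
  have hRL := Real.tendsto_integral_exp_smul_cocompact
    ((Set.Ioc (-1 : ℝ) 1).indicator fun τ ↦ ((1 - |τ| : ℝ) : ℂ) * Φ (1 + τ * c * Complex.I))
  have hmap : Tendsto (fun x : ℝ ↦ -(c / (2 * Real.pi)) * x) atTop (cocompact ℝ) := by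
    rw [cocompact_eq_atBot_atTop]
    refine Tendsto.mono_right ?_ le_sup_left
    exact tendsto_id.const_mul_atTop_of_neg (by
      have := Real.pi_pos
      have : 0 < c / (2 * Real.pi) := by positivity
      linarith)
  have h := hRL.comp hmap
  have key (x : ℝ) : ((∫ y in Set.Ioi (0 : ℝ), (psiExp y - 1) * fejerKernel (c * (x - y)) : ℝ) : ℂ)
      = ∫ v : ℝ, Real.fourierChar (-(v * (-(c / (2 * Real.pi)) * x))) •
        (Set.Ioc (-1 : ℝ) 1).indicator
          (fun τ ↦ ((1 - |τ| : ℝ) : ℂ) * Φ (1 + τ * c * Complex.I)) v := by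
    rw [← integral_complex_ofReal]
    simp_rw [Complex.ofReal_mul]
    rw [integral_psiExp_fejer hΦc hΦ hc, intervalIntegral.integral_of_le (by norm_num),
      ← integral_indicator measurableSet_Ioc]
    refine integral_congr_ae (.of_forall fun τ ↦ ?_)
    by_cases hτ : τ ∈ Set.Ioc (-1 : ℝ) 1
    · simp only [Set.indicator_of_mem hτ]
      rw [Circle.smul_def, Real.fourierChar_apply, smul_eq_mul]
      have : (2 * Real.pi * -(τ * (-(c / (2 * Real.pi)) * x)) : ℝ) = τ * (c * x) := by
        have := Real.pi_ne_zero
        field_simp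
      rw [this]
      push_cast
      ring
    · simp only [Set.indicator_of_notMem hτ, smul_zero]
  have h2 : Tendsto (fun x ↦ ((∫ y in Set.Ioi (0 : ℝ),
      (psiExp y - 1) * fejerKernel (c * (x - y)) : ℝ) : ℂ)) atTop (𝓝 0) :=
    h.congr fun x ↦ (key x).symm
  have := (Complex.continuous_re.tendsto 0).comp h2
  simpa [Function.comp_def] using this

lemma eventually_psiExp_le {ε : ℝ} (hε : 0 < ε) : ∀ᶠ x in atTop, psiExp x ≤ Real.exp ε := by
  set I := ∫ v, fejerKernel v with hI
  have hIpos : 0 < I := integral_fejerKernel_pos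
  set δ := ε / 6 with hδ
  have hδpos : 0 < δ := by positivity
  have hconc : Tendsto (fun c : ℝ ↦ ∫ v in (-(c * δ))..(c * δ), fejerKernel v) atTop (𝓝 I) := by
    have h1 : Tendsto (fun c : ℝ ↦ c * δ) atTop atTop := tendsto_id.atTop_mul_const hδpos
    exact intervalIntegral_tendsto_integral integrable_fejerKernel
      (tendsto_neg_atTop_atBot.comp h1) h1
  have hlt : Real.exp (-δ) * I < I := by
    have : Real.exp (-δ) < 1 := Real.exp_lt_one_iff.2 (by linarith)
    nlinarith
  obtain ⟨c, hcI, hc⟩ := ((hconc.eventually (lt_mem_nhds hlt)).and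
    (eventually_gt_atTop 0)).exists
  have herr : 0 < (Real.exp δ - 1) * I / c := by
    have : 1 < Real.exp δ := Real.one_lt_exp_iff.2 hδpos
    have : 0 < Real.exp δ - 1 := by linarith
    positivity
  have h1 := (tendsto_integral_psiExp_fejer hc).eventually (gt_mem_nhds herr)
  have h2 : ∀ᶠ x in atTop, psiExp (x - δ) ≤ Real.exp ε := by
    filter_upwards [h1, eventually_gt_atTop δ] with x hx hxδ
    have hker : Integrable fun y ↦ fejerKernel (c * (x - y)) :=
      (integrable_fejerKernel.comp_mul_left' hc.ne').comp_sub_left x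
    have hkerI : ∫ y, fejerKernel (c * (x - y)) = I / c := by
      rw [integral_sub_left_eq_self (fun y ↦ fejerKernel (c * y)) volume x,
        Measure.integral_comp_mul_left, abs_of_pos (inv_pos.2 hc), smul_eq_mul, hI]
      ring
    have hpk : Integrable fun y ↦ psiExp y * fejerKernel (c * (x - y)) := by
      refine hker.bdd_mul (c := Real.log 4 + 4) measurable_psiExp.aestronglyMeasurable
        (.of_forall fun y ↦ ?_)
      rw [Real.norm_of_nonneg (psiExp_nonneg y)]
      exact psiExp_le y
    have hnn (y : ℝ) : 0 ≤ psiExp y * fejerKernel (c * (x - y)) :=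
      mul_nonneg (psiExp_nonneg _) (fejerKernel_nonneg _)
    have hup : ∫ y in Set.Ioi (0 : ℝ), psiExp y * fejerKernel (c * (x - y)) ≤
        Real.exp δ * (I / c) := by
      simp_rw [sub_mul, one_mul] at hx
      rw [integral_sub hpk.integrableOn hker.integrableOn] at hx
      have : ∫ y in Set.Ioi (0 : ℝ), fejerKernel (c * (x - y)) ≤ I / c := by
        rw [← hkerI]
        exact setIntegral_le_integral hker (.of_forall fun y ↦ fejerKernel_nonneg _)
      have e : (Real.exp δ * I - I) / c = Real.exp δ * (I / c) - I / c := by ring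
      linarith
    have hlow : psiExp (x - δ) * Real.exp (-(2 * δ)) * (Real.exp (-δ) * I / c) ≤
        ∫ y in Set.Ioi (0 : ℝ), psiExp y * fejerKernel (c * (x - y)) := by
      have hle : x - δ ≤ x + δ := by linarith
      have hInt : ∫ y in Set.Ioc (x - δ) (x + δ), fejerKernel (c * (x - y)) =
          (∫ v in (-(c * δ))..(c * δ), fejerKernel v) / c := by
        rw [← intervalIntegral.integral_of_le hle]
        rw [intervalIntegral.integral_comp_sub_left (fun y ↦ fejerKernel (c * y)),
          intervalIntegral.integral_comp_mul_left _ hc.ne', smul_eq_mul]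
        ring_nf
      calc _ ≤ psiExp (x - δ) * Real.exp (-(2 * δ)) *
            ∫ y in Set.Ioc (x - δ) (x + δ), fejerKernel (c * (x - y)) := by
            rw [hInt]
            have := psiExp_nonneg (x - δ)
            gcongr
        _ = ∫ y in Set.Ioc (x - δ) (x + δ),
              psiExp (x - δ) * Real.exp (-(2 * δ)) * fejerKernel (c * (x - y)) := by
            rw [integral_const_mul]
        _ ≤ ∫ y in Set.Ioc (x - δ) (x + δ), psiExp y * fejerKernel (c * (x - y)) := by
            refine setIntegral_mono_on (hker.const_mul _).integrableOn hpk.integrableOn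
              measurableSet_Ioc fun y hy ↦ ?_
            refine mul_le_mul_of_nonneg_right ?_ (fejerKernel_nonneg _)
            refine le_trans ?_ (psiExp_mul_exp_le hy.1.le)
            refine mul_le_mul_of_nonneg_left (Real.exp_le_exp.2 ?_) (psiExp_nonneg _)
            linarith [hy.2]
        _ ≤ _ := by
            refine setIntegral_mono_set hpk.integrableOn (.of_forall hnn)
              (LE.le.eventuallyLE fun y hy ↦ ?_)
            exact lt_trans (by linarith) hy.1
    have hcomb := hlow.trans hup
    have hIc : 0 < I / c := by positivity
    have e1 : psiExp (x - δ) * Real.exp (-(2 * δ)) * (Real.exp (-δ) * I / c) =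
        (psiExp (x - δ) * Real.exp (-(3 * δ))) * (I / c) := by
      rw [show -(3 * δ) = -(2 * δ) + -δ by ring, Real.exp_add]
      ring
    rw [e1] at hcomb
    have h4 := le_of_mul_le_mul_right hcomb hIc
    calc psiExp (x - δ) = psiExp (x - δ) * Real.exp (-(3 * δ)) * Real.exp (3 * δ) := by
          rw [mul_assoc, ← Real.exp_add]; simp
      _ ≤ Real.exp δ * Real.exp (3 * δ) := by gcongr
      _ ≤ Real.exp ε := by
          rw [← Real.exp_add]
          exact Real.exp_le_exp.2 (by rw [hδ]; linarith)
  have h3 := (tendsto_atTop_add_const_right atTop δ tendsto_id).eventually h2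
  simpa using h3

/-- The upper bound of the prime number theorem, for least common multiples. -/
theorem eventually_lcmUpto_le {ε : ℝ} (hε : 0 < ε) :
    ∀ᶠ n : ℕ in atTop, (Nat.lcmUpto n : ℝ) ≤ Real.exp ((1 + ε) * n) := by
  have hlog : Tendsto (fun n : ℕ ↦ Real.log n) atTop atTop :=
    Real.tendsto_log_atTop.comp tendsto_natCast_atTop_atTop
  have h1 : 0 < Real.log (1 + ε) := Real.log_pos (by linarith)
  filter_upwards [hlog.eventually (eventually_psiExp_le h1), eventually_gt_atTop 0] with n hn hn0
  have hn' : (0 : ℝ) < n := by exact_mod_cast hn0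
  rw [psiExp, Real.exp_neg, Real.exp_log hn', Real.exp_log (by linarith),
    ← div_eq_mul_inv, div_le_iff₀ hn', Chebyshev.psi_eq_log_lcmUpto] at hn
  have hpos : (0 : ℝ) < Nat.lcmUpto n := by exact_mod_cast Nat.lcmUpto_pos n
  exact (Real.log_le_iff_le_exp hpos).1 hn

/-- Dirichlet's theorem on simultaneous Diophantine approximation. -/
lemma exists_simultaneous_approx {ι : Type*} [Fintype ι] (θ : ι → ℝ) {N : ℕ} (hN : 0 < N) :
    ∃ q : ℕ, 1 ≤ q ∧ q ≤ N ^ Fintype.card ι ∧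
      ∃ r : ι → ℤ, ∀ i, |q * θ i - r i| ≤ 1 / N := by
  classical
  have hN' : (0 : ℝ) < N := by exact_mod_cast hN
  have hfl (x : ℝ) : ⌊Int.fract x * N⌋₊ < N := by
    rw [Nat.floor_lt (mul_nonneg (Int.fract_nonneg x) hN'.le)]
    have := Int.fract_lt_one x
    nlinarith
  let f : Fin (N ^ Fintype.card ι + 1) → (ι → Fin N) := fun q i ↦
    ⟨⌊Int.fract ((q : ℕ) * θ i) * N⌋₊, hfl _⟩
  obtain ⟨x, y, hxy, hf⟩ := Fintype.exists_ne_map_eq_of_card_lt f (by simp)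
  wlog hlt : x < y generalizing x y
  · exact this y x hxy.symm hf.symm (lt_of_le_of_ne (not_lt.1 hlt) hxy.symm)
  have hlt' : (x : ℕ) < y := hlt
  refine ⟨y - x, by omega, by have := y.2; omega,
    fun i ↦ ⌊((y : ℕ) : ℝ) * θ i⌋ - ⌊((x : ℕ) : ℝ) * θ i⌋, fun i ↦ ?_⟩
  have h1 : ⌊Int.fract (((x : ℕ) : ℝ) * θ i) * N⌋₊ = ⌊Int.fract (((y : ℕ) : ℝ) * θ i) * N⌋₊ :=
    congrArg Fin.val (congrFun hf i)
  have hx0 := mul_nonneg (Int.fract_nonneg (((x : ℕ) : ℝ) * θ i)) hN'.le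
  have hy0 := mul_nonneg (Int.fract_nonneg (((y : ℕ) : ℝ) * θ i)) hN'.le
  have hx1 := Nat.floor_le hx0
  have hx2 := Nat.lt_floor_add_one (Int.fract (((x : ℕ) : ℝ) * θ i) * N)
  have hy1 := Nat.floor_le hy0
  have hy2 := Nat.lt_floor_add_one (Int.fract (((y : ℕ) : ℝ) * θ i) * N)
  rw [h1] at hx1 hx2
  have e : (((y : ℕ) - (x : ℕ) : ℕ) : ℝ) * θ i -
      ((⌊((y : ℕ) : ℝ) * θ i⌋ - ⌊((x : ℕ) : ℝ) * θ i⌋ : ℤ) : ℝ) =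
      Int.fract (((y : ℕ) : ℝ) * θ i) - Int.fract (((x : ℕ) : ℝ) * θ i) := by
    rw [Nat.cast_sub hlt'.le, Int.fract, Int.fract]
    push_cast
    ring
  have hmul (a : ℝ) : |a| * N = |a * N| := by rw [abs_mul, abs_of_pos hN']
  simp only
  rw [e, le_div_iff₀ hN', hmul, sub_mul, abs_le]
  constructor <;> linarith

/-- Nesterenko's linear independence criterion, with two-sided exponential bounds. -/
theorem nesterenko_criterion {ι : Type*} [Fintype ι] (θ : ι → ℝ) (p₀ : ℕ → ℤ) (p : ℕ → ι → ℤ)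
    {K a₁ a₂ b : ℝ} (hK : 1 ≤ K) (ha₁ : 0 < a₁) (ha : a₁ ≤ a₂)
    (hlow : ∀ᶠ n : ℕ in atTop, Real.exp (-a₂ * n) ≤ |p₀ n + ∑ i, p n i * θ i|)
    (hup : ∀ᶠ n : ℕ in atTop, |p₀ n + ∑ i, p n i * θ i| ≤ K * Real.exp (-a₁ * n))
    (hp : ∀ᶠ n : ℕ in atTop, ∀ i, |(p n i : ℝ)| ≤ K * Real.exp (b * n)) :
    a₁ ≤ Fintype.card ι * (b + a₂ - a₁) := by
  by_contra! hcon
  obtain ⟨n₀, hn₀⟩ := eventually_atTop.1 (hlow.and (hup.and hp))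
  set m : ℝ := (Fintype.card ι : ℝ) with hm
  set c := b + a₂ - a₁ with hc
  set C := 2 * K * Real.exp (a₁ * (n₀ + 1)) with hC
  have hm0 : 0 ≤ m := by positivity
  have hC2 : 2 ≤ C := by
    have : 1 ≤ Real.exp (a₁ * (n₀ + 1)) := Real.one_le_exp (by positivity)
    have : 1 ≤ K * Real.exp (a₁ * (n₀ + 1)) := one_le_mul_of_one_le_of_one_le hK this
    linarith
  have hC0 : 0 < C := by linarith
  have hK0 : 0 < K := by linarith
  set D := C * m * K with hD
  have hD0 : 0 ≤ D := by positivity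
  set B := C * D ^ Fintype.card ι / (a₁ - m * c) with hB
  obtain ⟨N, hN⟩ := exists_nat_gt (D * Real.exp (|c| * B))
  have hN0 : (0 : ℝ) < N := lt_of_le_of_lt (by positivity) hN
  obtain ⟨q, hq1, hqN, r, hr⟩ := exists_simultaneous_approx θ (N := N) (by exact_mod_cast hN0)
  have hq1' : (1 : ℝ) ≤ q := by exact_mod_cast hq1
  have hq0 : (0 : ℝ) < q := by linarith
  have h2q : 1 ≤ 2 * K * q := by nlinarith
  have hlog0 : 0 ≤ Real.log (2 * K * q) / a₁ := div_nonneg (Real.log_nonneg h2q) ha₁.le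
  set n := max n₀ ⌈Real.log (2 * K * q) / a₁⌉₊ with hn
  obtain ⟨hL1, hL2, hP⟩ := hn₀ n (le_max_left _ _)
  have hi : 2 * K * q ≤ Real.exp (a₁ * n) := by
    rw [← Real.log_le_iff_le_exp (by linarith)]
    have h1 : Real.log (2 * K * q) / a₁ ≤ n :=
      (Nat.le_ceil _).trans (by exact_mod_cast le_max_right _ _)
    rwa [div_le_iff₀ ha₁, mul_comm (n : ℝ)] at h1
  have hii : Real.exp (a₁ * n) ≤ C * q := by
    have h1 : (n : ℝ) ≤ n₀ + (Real.log (2 * K * q) / a₁ + 1) := by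
      rw [hn]
      push_cast
      refine max_le (by linarith) ?_
      linarith [Nat.ceil_lt_add_one hlog0, Nat.cast_nonneg (α := ℝ) n₀]
    calc Real.exp (a₁ * n) ≤ Real.exp (a₁ * (n₀ + 1) + Real.log (2 * K * q)) := by
          refine Real.exp_le_exp.2 ((mul_le_mul_of_nonneg_left h1 ha₁.le).trans_eq ?_)
          field_simp
          ring
      _ = C * q := by
          rw [Real.exp_add, Real.exp_log (by linarith), hC]
          ring
  set L := p₀ n + ∑ i, p n i * θ i with hL
  have hiii : q * |L| ≤ 1 / 2 := by
    have h1 : Real.exp (-a₁ * n) * Real.exp (a₁ * n) = 1 := by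
      rw [← Real.exp_add]; simp
    have h2 : q * |L| ≤ q * (K * Real.exp (-a₁ * n)) := by gcongr
    have h3 := mul_le_mul_of_nonneg_left hi (Real.exp_pos (-a₁ * n)).le
    nlinarith
  have hiv : Real.exp (-(a₂ - a₁) * n) ≤ C * (q * |L|) := by
    have h1 : Real.exp (-(a₂ - a₁) * n) = Real.exp (a₁ * n) * Real.exp (-a₂ * n) := by
      rw [← Real.exp_add]; ring_nf
    rw [h1, ← mul_assoc]
    gcongr
  set Z : ℤ := q * p₀ n + ∑ i, p n i * r i with hZ
  have hv : |q * L - Z| ≤ m * (K * Real.exp (b * n)) / N := by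
    have h1 : q * L - Z = ∑ i, (p n i : ℝ) * (q * θ i - r i) := by
      rw [hL, hZ]
      push_cast
      rw [mul_add, Finset.mul_sum, add_sub_add_left_eq_sub, ← Finset.sum_sub_distrib]
      exact Finset.sum_congr rfl fun i _ ↦ by ring
    rw [h1]
    calc _ ≤ ∑ i : ι, |(p n i : ℝ) * (q * θ i - r i)| := Finset.abs_sum_le_sum_abs _ _
      _ ≤ ∑ i : ι, K * Real.exp (b * n) * (1 / N) := by
          refine Finset.sum_le_sum fun i _ ↦ ?_
          rw [abs_mul]
          exact mul_le_mul (hP i) (hr i) (abs_nonneg _) (by positivity)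
      _ = _ := by
          rw [Finset.sum_const, Finset.card_univ, nsmul_eq_mul]
          ring
  have hqL : |q * L| = q * |L| := by rw [abs_mul, abs_of_pos hq0]
  have hexp : Real.exp (c * n) = Real.exp (b * n) * Real.exp ((a₂ - a₁) * n) := by
    rw [← Real.exp_add, hc]; ring_nf
  have hexp1 : 1 ≤ Real.exp ((a₂ - a₁) * n) :=
    Real.one_le_exp (mul_nonneg (by linarith) (Nat.cast_nonneg _))
  have hND : N ≤ D * Real.exp (c * n) := by
    rw [le_div_iff₀ hN0] at hv
    have hb0 := Real.exp_pos (b * n)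
    by_cases hZ0 : Z = 0
    · rw [hZ0, Int.cast_zero, sub_zero, hqL] at hv
      have h1 : Real.exp (-(a₂ - a₁) * n) * Real.exp ((a₂ - a₁) * n) = 1 := by
        rw [← Real.exp_add]; ring_nf; simp
      calc (N : ℝ) = Real.exp (-(a₂ - a₁) * n) * Real.exp ((a₂ - a₁) * n) * N := by
            rw [h1, one_mul]
        _ ≤ C * (q * |L|) * Real.exp ((a₂ - a₁) * n) * N := by gcongr
        _ = C * (q * |L| * N) * Real.exp ((a₂ - a₁) * n) := by ring
        _ ≤ C * (m * (K * Real.exp (b * n))) * Real.exp ((a₂ - a₁) * n) := by gcongr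
        _ = _ := by rw [hexp, hD]; ring
    · have h1 : (1 : ℝ) ≤ |(Z : ℝ)| := by exact_mod_cast Int.one_le_abs hZ0
      have h2 : 1 / 2 ≤ |q * L - Z| := by
        have := abs_sub_abs_le_abs_sub (Z : ℝ) (q * L)
        rw [abs_sub_comm, hqL] at this
        linarith
      have h3 : (N : ℝ) ≤ 2 * (m * (K * Real.exp (b * n))) := by nlinarith
      calc (N : ℝ) ≤ 2 * (m * (K * Real.exp (b * n))) * 1 := by linarith
        _ ≤ C * (m * (K * Real.exp (b * n))) * Real.exp ((a₂ - a₁) * n) := by gcongr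
        _ = _ := by rw [hexp, hD]; ring
  have hnB : (n : ℝ) ≤ B := by
    have hpos : 0 < a₁ - m * c := by linarith
    rw [hB, le_div_iff₀ hpos]
    have h1 : Real.exp (a₁ * n) ≤ C * D ^ Fintype.card ι * Real.exp (m * c * n) := by
      calc Real.exp (a₁ * n) ≤ C * q := hii
        _ ≤ C * (N : ℝ) ^ Fintype.card ι := by gcongr; exact_mod_cast hqN
        _ ≤ C * (D * Real.exp (c * n)) ^ Fintype.card ι := by gcongr
        _ = _ := by
          rw [mul_pow, ← Real.exp_nat_mul, hm]
          ring_nf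
    have h2 : Real.exp ((a₁ - m * c) * n) ≤ C * D ^ Fintype.card ι := by
      rw [sub_mul, Real.exp_sub, div_le_iff₀ (Real.exp_pos _)]
      exact h1
    linarith [Real.add_one_le_exp ((a₁ - m * c) * n)]
  have : D * Real.exp (c * n) ≤ D * Real.exp (|c| * B) := by
    gcongr
    exact le_abs_self c
  linarith

lemma exists_common_denominator {α : Type*} [Fintype α] (f : α → ℚ) :
    ∃ D : ℕ, 0 < D ∧ ∀ x, ∃ z : ℤ, (z : ℚ) = D * f x := by
  classical
  refine ⟨∏ x, (f x).den, Finset.prod_pos fun x _ ↦ (f x).den_pos, fun x ↦ ?_⟩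
  refine ⟨(∏ y ∈ Finset.univ.erase x, ((f y).den : ℤ)) * (f x).num, ?_⟩
  rw [← Finset.mul_prod_erase _ _ (Finset.mem_univ x)]
  push_cast
  have := Rat.mul_den_eq_num (f x)
  linear_combination (-∏ y ∈ Finset.univ.erase x, ((f y).den : ℚ)) * this

/-- Nesterenko's criterion as a lower bound for the dimension of a rational span. -/
theorem nesterenko_finrank {ι : Type*} [Fintype ι] (v : ι → ℝ) (p₀ : ℕ → ℤ) (p : ℕ → ι → ℤ)
    {a₁ a₂ b : ℝ} (ha₁ : 0 < a₁) (ha : a₁ ≤ a₂)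
    (hlow : ∀ᶠ n : ℕ in atTop, Real.exp (-a₂ * n) ≤ |p₀ n + ∑ i, p n i * v i|)
    (hup : ∀ᶠ n : ℕ in atTop, |p₀ n + ∑ i, p n i * v i| ≤ Real.exp (-a₁ * n))
    (hp : ∀ᶠ n : ℕ in atTop, ∀ i, |(p n i : ℝ)| ≤ Real.exp (b * n)) :
    a₁ ≤ (Module.finrank ℚ (Submodule.span ℚ ({1} ∪ Set.range v)) - 1) * (b + a₂ - a₁) := by
  classical
  obtain ⟨s, hst, h1s, hts, hs⟩ := exists_linearIndepOn_id_extension (K := ℚ)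
    (s := ({1} : Set ℝ)) (t := {1} ∪ Set.range v)
    (LinearIndepOn.singleton (v := id) one_ne_zero) Set.subset_union_left
  have hsfin : s.Finite := ((Set.finite_singleton _).union (Set.finite_range v)).subset hst
  have hspan : Submodule.span ℚ ({1} ∪ Set.range v) = Submodule.span ℚ s :=
    le_antisymm (Submodule.span_le.2 hts) (Submodule.span_mono hst)
  have h1 : (1 : ℝ) ∈ s := h1s rfl
  let s' : Set ℝ := s \ {1}
  have hs'fin : s'.Finite := hsfin.subset Set.sdiff_subset
  let : Fintype s' := hs'fin.fintype
  let : Fintype s := hsfin.fintype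
  have hcard : Module.finrank ℚ (Submodule.span ℚ ({1} ∪ Set.range v)) =
      Fintype.card s' + 1 := by
    rw [hspan, finrank_span_set_eq_card hs, Set.toFinset_card]
    have : s = insert 1 s' := by simp [s', h1]
    rw [← Nat.card_eq_fintype_card, ← Nat.card_eq_fintype_card, Nat.card_coe_set_eq,
      Nat.card_coe_set_eq, this, Set.ncard_insert_of_notMem (by simp [s']) hs'fin]
  have hcoef (i : ι) : ∃ (c₀ : ℚ) (c : s' → ℚ), v i = c₀ + ∑ x : s', (c x : ℝ) * (x : ℝ) := by
    have hi : v i ∈ Submodule.span ℚ s := hts (Or.inr ⟨i, rfl⟩)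
    have : s = insert 1 s' := by simp [s', h1]
    rw [this, Submodule.mem_span_insert] at hi
    obtain ⟨c₀, z, hz, hvi⟩ := hi
    rw [← Subtype.range_coe (s := s'), Submodule.mem_span_range_iff_exists_fun] at hz
    obtain ⟨c, hc⟩ := hz
    refine ⟨c₀, c, ?_⟩
    rw [hvi, ← hc]
    simp [Rat.smul_def]
  choose c₀ c hc using hcoef
  obtain ⟨D, hD0, hD⟩ := exists_common_denominator
    (fun x : ι × Option s' ↦ x.2.elim (c₀ x.1) (c x.1))
  choose z hz using hD
  have hz0 (i : ι) : (z (i, none) : ℝ) = D * c₀ i := by exact_mod_cast hz (i, none)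
  have hz1 (i : ι) (x : s') : (z (i, some x) : ℝ) = D * c i x := by exact_mod_cast hz (i, some x)
  have hD1 : (1 : ℝ) ≤ D := by exact_mod_cast hD0
  let P₀ : ℕ → ℤ := fun n ↦ D * p₀ n + ∑ i, p n i * z (i, none)
  let P : ℕ → s' → ℤ := fun n x ↦ ∑ i, p n i * z (i, some x)
  have hform (n : ℕ) : (P₀ n + ∑ x : s', P n x * (x : ℝ) : ℝ) =
      D * (p₀ n + ∑ i, p n i * v i) := by
    have h1 : ∑ x : s', (P n x : ℝ) * (x : ℝ) =
        ∑ i, (p n i : ℝ) * ∑ x : s', D * (c i x : ℝ) * (x : ℝ) := by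
      simp only [P]
      push_cast
      simp only [hz1, Finset.sum_mul, Finset.mul_sum]
      rw [Finset.sum_comm]
      exact Finset.sum_congr rfl fun i _ ↦ Finset.sum_congr rfl fun x _ ↦ by ring
    have h2 : (P₀ n : ℝ) = D * p₀ n + ∑ i, (p n i : ℝ) * (D * c₀ i) := by
      simp only [P₀]
      push_cast
      simp only [hz0]
    rw [h1, h2, mul_add, Finset.mul_sum, add_assoc, ← Finset.sum_add_distrib]
    congr 1
    refine Finset.sum_congr rfl fun i _ ↦ ?_
    rw [hc i]
    simp only [mul_assoc, ← Finset.mul_sum]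
    ring
  set W : ℝ := ∑ y : ι × Option s', |(z y : ℝ)| with hW
  have hW0 : 0 ≤ W := Finset.sum_nonneg fun _ _ ↦ abs_nonneg _
  have hcrit := nesterenko_criterion (fun x : s' ↦ (x : ℝ)) P₀ P (K := D + W)
    (a₁ := a₁) (a₂ := a₂) (b := b) (by linarith) ha₁ ha ?_ ?_ ?_
  · rw [hcard]
    push_cast
    rwa [add_sub_cancel_right]
  · filter_upwards [hlow] with n hn
    rw [hform, abs_mul, Nat.abs_cast]
    nlinarith [abs_nonneg (p₀ n + ∑ i, p n i * v i)]
  · filter_upwards [hup] with n hn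
    rw [hform, abs_mul, Nat.abs_cast]
    have := Real.exp_pos (-a₁ * n)
    calc _ ≤ (D : ℝ) * Real.exp (-a₁ * n) := by gcongr
      _ ≤ _ := by gcongr; linarith
  · filter_upwards [hp] with n hn x
    simp only [P]
    push_cast
    calc _ ≤ ∑ i, |(p n i : ℝ) * z (i, some x)| := Finset.abs_sum_le_sum_abs _ _
      _ ≤ ∑ i, Real.exp (b * n) * |(z (i, some x) : ℝ)| := by
          refine Finset.sum_le_sum fun i _ ↦ ?_
          rw [abs_mul]
          gcongr
          exact hn i
      _ = (∑ i, |(z (i, some x) : ℝ)|) * Real.exp (b * n) := by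
          rw [← Finset.mul_sum, mul_comm]
      _ ≤ W * Real.exp (b * n) := by
          gcongr
          rw [hW, Fintype.sum_prod_type]
          exact Finset.sum_le_sum fun i _ ↦ Finset.single_le_sum
            (f := fun y : Option s' ↦ |(z (i, y) : ℝ)|) (fun _ _ ↦ abs_nonneg _)
            (Finset.mem_univ (some x))
      _ ≤ _ := by gcongr; linarith

/-- `f` is a combination of the fractions `1 / (t + j) ^ (l + 1)` with `j ≤ n` and `l < d`, where
the coefficients have absolute sum at most `B` and controlled denominators. The auxiliary `M`
bounds the orders of all fractions under consideration. -/
def HasPartialFraction (n M d : ℕ) (B : ℝ) (f : ℝ → ℝ) : Prop :=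
  ∃ c : ℕ × ℕ → ℝ,
    (∀ t : ℝ, (∀ j ≤ n, t + j ≠ 0) →
      f t = ∑ x ∈ Finset.range M ×ˢ Finset.range (n + 1), c x / (t + x.2) ^ (x.1 + 1)) ∧
    (∀ x, d ≤ x.1 → c x = 0) ∧
    (∀ x, ∃ z : ℤ, (Nat.lcmUpto n : ℝ) ^ (d - 1 - x.1) * c x = z) ∧
    ∑ x ∈ Finset.range M ×ˢ Finset.range (n + 1), |c x| ≤ B

namespace HasPartialFraction

variable {n M d : ℕ} {B : ℝ} {f : ℝ → ℝ}

lemma mono {B' : ℝ} (h : HasPartialFraction n M d B f) (hB : B ≤ B') :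
    HasPartialFraction n M d B' f := by
  obtain ⟨c, h1, h2, h3, h4⟩ := h
  exact ⟨c, h1, h2, h3, h4.trans hB⟩

lemma congr {g : ℝ → ℝ} (h : HasPartialFraction n M d B f)
    (hfg : ∀ t : ℝ, (∀ j ≤ n, t + j ≠ 0) → g t = f t) : HasPartialFraction n M d B g := by
  obtain ⟨c, h1, h2, h3, h4⟩ := h
  exact ⟨c, fun t ht ↦ (hfg t ht).trans (h1 t ht), h2, h3, h4⟩

lemma zero : HasPartialFraction n M d 0 0 :=
  ⟨0, by simp, by simp, fun x ↦ ⟨0, by simp⟩, by simp⟩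

lemma add {B' : ℝ} {g : ℝ → ℝ} (hf : HasPartialFraction n M d B f)
    (hg : HasPartialFraction n M d B' g) : HasPartialFraction n M d (B + B') (f + g) := by
  obtain ⟨c, h1, h2, h3, h4⟩ := hf
  obtain ⟨c', h1', h2', h3', h4'⟩ := hg
  refine ⟨c + c', fun t ht ↦ ?_, fun x hx ↦ ?_, fun x ↦ ?_, ?_⟩
  · simp only [Pi.add_apply, h1 t ht, h1' t ht, ← Finset.sum_add_distrib, add_div]
  · simp [h2 x hx, h2' x hx]
  · obtain ⟨z, hz⟩ := h3 x
    obtain ⟨z', hz'⟩ := h3' x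
    exact ⟨z + z', by push_cast; rw [← hz, ← hz', Pi.add_apply, mul_add]⟩
  · refine le_trans ?_ (add_le_add h4 h4')
    rw [← Finset.sum_add_distrib]
    exact Finset.sum_le_sum fun x _ ↦ abs_add_le _ _

lemma sum {ι : Type*} (s : Finset ι) {B : ι → ℝ} {f : ι → ℝ → ℝ}
    (h : ∀ i ∈ s, HasPartialFraction n M d (B i) (f i)) :
    HasPartialFraction n M d (∑ i ∈ s, B i) (∑ i ∈ s, f i) := by
  classical
  induction s using Finset.induction_on with
  | empty => simpa using zero
  | insert i s hi ih =>
    rw [Finset.sum_insert hi, Finset.sum_insert hi]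
    exact (h i (Finset.mem_insert_self _ _)).add
      (ih fun j hj ↦ h j (Finset.mem_insert_of_mem hj))

lemma smul {e : ℕ} {u : ℝ} (hu : ∃ z : ℤ, (Nat.lcmUpto n : ℝ) ^ e * u = z)
    (h : HasPartialFraction n M d B f) :
    HasPartialFraction n M (d + e) (|u| * B) (u • f) := by
  obtain ⟨c, h1, h2, h3, h4⟩ := h
  refine ⟨u • c, fun t ht ↦ ?_, fun x hx ↦ ?_, fun x ↦ ?_, ?_⟩
  · simp only [Pi.smul_apply, smul_eq_mul, h1 t ht, Finset.mul_sum, mul_div_assoc]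
  · simp [h2 x (by omega)]
  · by_cases hx : d ≤ x.1
    · exact ⟨0, by simp [h2 x hx]⟩
    · obtain ⟨z, hz⟩ := h3 x
      obtain ⟨z', hz'⟩ := hu
      refine ⟨z' * z, ?_⟩
      have : d + e - 1 - x.1 = e + (d - 1 - x.1) := by omega
      push_cast
      rw [← hz, ← hz', this, pow_add, Pi.smul_apply, smul_eq_mul]
      ring
  · simp only [Pi.smul_apply, smul_eq_mul, abs_mul, ← Finset.mul_sum]
    gcongr

lemma monomial {l j : ℕ} (hl : l < M) (hj : j ≤ n) :
    HasPartialFraction n M (l + 1) 1 fun t ↦ 1 / (t + j) ^ (l + 1) := by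
  have hmem : (l, j) ∈ Finset.range M ×ˢ Finset.range (n + 1) := by
    simp only [Finset.mem_product, Finset.mem_range]; omega
  refine ⟨Pi.single (l, j) 1, fun t _ ↦ ?_, fun x hx ↦ ?_, fun x ↦ ?_, ?_⟩
  · rw [Finset.sum_eq_single_of_mem _ hmem]
    · simp
    · intro x _ hx
      simp [Pi.single_eq_of_ne hx]
  · exact Pi.single_eq_of_ne (by rintro rfl; simp at hx) _
  · by_cases hx : x = (l, j)
    · subst hx
      exact ⟨1, by simp⟩
    · exact ⟨0, by simp [Pi.single_eq_of_ne hx]⟩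
  · rw [Finset.sum_eq_single_of_mem _ hmem]
    · simp
    · intro x _ hx
      simp [Pi.single_eq_of_ne hx]

end HasPartialFraction

lemma dvd_lcmUpto {n D : ℕ} (h0 : 0 < D) (h : D ≤ n) : D ∣ Nat.lcmUpto n :=
  Finset.dvd_lcm (f := id) (Finset.mem_Icc.2 ⟨h0, h⟩)

lemma lcmUpto_mul_inv_sub {n j p : ℕ} (hj : j ≤ n) (hp : p ≤ n) (hjp : j ≠ p) :
    ∃ z : ℤ, (Nat.lcmUpto n : ℝ) ^ 1 * ((p : ℝ) - j)⁻¹ = z := by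
  have hne : ((p : ℝ) - j) ≠ 0 := sub_ne_zero.2 (by exact_mod_cast hjp.symm)
  have h1 : ((p : ℤ) - j) ∣ (Nat.lcmUpto n : ℤ) := by
    rw [← Int.natAbs_dvd]
    exact Int.natCast_dvd_natCast.2 (dvd_lcmUpto (by omega) (by omega))
  obtain ⟨z, hz⟩ := h1
  refine ⟨z, ?_⟩
  have hz' : (Nat.lcmUpto n : ℝ) = ((p : ℝ) - j) * z := by exact_mod_cast hz
  rw [hz', pow_one]
  field_simp

lemma abs_inv_sub_le_one {j p : ℕ} (hjp : j ≠ p) : |((p : ℝ) - j)⁻¹| ≤ 1 := by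
  rw [abs_inv]
  refine inv_le_one_of_one_le₀ ?_
  have h : 1 ≤ |(p : ℤ) - j| := Int.one_le_abs (by omega)
  exact_mod_cast h

lemma HasPartialFraction.monomial_mul {n M j p : ℕ} (hj : j ≤ n) (hp : p ≤ n) (m : ℕ)
    (hm : m < M) :
    HasPartialFraction n M (m + 1) (m + 1) fun t ↦ 1 / (t + j) ^ m * (1 / (t + p)) := by
  by_cases hjp : j = p
  · subst hjp
    refine ((monomial hm hj).mono (by simp)).congr fun t ht ↦ ?_
    rw [pow_succ, one_div_mul_one_div]
  induction m with
  | zero =>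
    refine ((monomial hm hp).mono (by simp)).congr fun t ht ↦ ?_
    simp
  | succ m ih =>
    have h1 := (monomial (n := n) (M := M) (l := m) (by omega) hj).add
      (((ih (by omega)).smul (e := 0) (u := -1) ⟨-1, by simp⟩))
    have h2 := h1.smul (e := 1) (lcmUpto_mul_inv_sub hj hp hjp)
    refine (h2.mono ?_).congr fun t ht ↦ ?_
    · have := abs_inv_sub_le_one hjp
      have h3 : (1 : ℝ) + |-1| * (m + 1) = m + 1 + 1 := by simp; ring
      rw [h3]
      push_cast
      have : (0 : ℝ) ≤ m + 1 + 1 := by positivity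
      nlinarith
    · have hne : ((p : ℝ) - j) ≠ 0 := sub_ne_zero.2 (by exact_mod_cast Ne.symm hjp)
      have ht1 := ht j hj
      have ht2 := ht p hp
      simp only [Pi.smul_apply, Pi.add_apply, smul_eq_mul]
      field_simp
      ring

/-- `g` is an integral combination of the fractions `1 / (t + p)` with `p ≤ n`. -/
def HasSimpleFraction (n : ℕ) (B : ℝ) (g : ℝ → ℝ) : Prop :=
  ∃ z : ℕ → ℤ, (∀ t : ℝ, (∀ j ≤ n, t + j ≠ 0) → g t = ∑ p ∈ Finset.range (n + 1), z p / (t + p)) ∧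
    ∑ p ∈ Finset.range (n + 1), |(z p : ℝ)| ≤ B

lemma HasSimpleFraction.hasPartialFraction {n M : ℕ} {B : ℝ} {g : ℝ → ℝ} (hM : 0 < M)
    (h : HasSimpleFraction n B g) : HasPartialFraction n M 1 B g := by
  obtain ⟨z, h1, h2⟩ := h
  have := HasPartialFraction.sum (n := n) (M := M) (Finset.range (n + 1)) fun p hp ↦
    (HasPartialFraction.monomial (j := p) hM (by simp at hp; omega)).smul (e := 0) (u := z p)
      ⟨z p, by simp⟩
  refine (this.mono (by simpa using h2)).congr fun t ht ↦ ?_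
  rw [h1 t ht]
  simp [Finset.sum_apply, div_eq_mul_inv]

lemma HasPartialFraction.mul {n M d : ℕ} {B B' : ℝ} {f g : ℝ → ℝ} (hd : d < M)
    (hf : HasPartialFraction n M d B f) (hg : HasSimpleFraction n B' g) :
    HasPartialFraction n M (d + 1) ((d + 1) * (B * B')) (f * g) := by
  obtain ⟨c, h1, h2, h3, h4⟩ := hf
  obtain ⟨z, h5, h6⟩ := hg
  have key : ∀ y ∈ (Finset.range M ×ˢ Finset.range (n + 1)) ×ˢ Finset.range (n + 1),
      HasPartialFraction n M (d + 1) (|c y.1 * z y.2| * (d + 1))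
        ((c y.1 * z y.2) •
          fun t : ℝ ↦ 1 / (t + y.1.2) ^ (y.1.1 + 1) * (1 / (t + y.2))) := by
    rintro ⟨⟨l, j⟩, p⟩ hy
    simp only [Finset.mem_product, Finset.mem_range] at hy
    by_cases hl : d ≤ l
    · simpa [h2 (l, j) hl] using zero
    have hE := monomial_mul (n := n) (M := M) (j := j) (p := p) (by omega) (by omega) (l + 1)
      (by omega)
    have hu : ∃ w : ℤ, (Nat.lcmUpto n : ℝ) ^ (d - 1 - l) * (c (l, j) * z p) = w := by
      obtain ⟨w, hw⟩ := h3 (l, j)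
      exact ⟨w * z p, by push_cast; rw [← hw, mul_assoc]⟩
    have := hE.smul hu
    rw [show l + 1 + 1 + (d - 1 - l) = d + 1 by omega] at this
    refine this.mono ?_
    gcongr
    omega
  refine ((HasPartialFraction.sum _ key).mono ?_).congr fun t ht ↦ ?_
  · rw [← Finset.sum_mul, mul_comm]
    simp only [abs_mul]
    rw [Finset.sum_product (f := fun x : (ℕ × ℕ) × ℕ ↦ |c x.1| * |(z x.2 : ℝ)|)]
    simp only
    rw [← Finset.sum_mul_sum]
    gcongr
    exact (Finset.sum_nonneg fun x _ ↦ abs_nonneg (c x)).trans h4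
  · simp only [Pi.mul_apply, h1 t ht, h5 t ht, Finset.sum_apply, Pi.smul_apply, smul_eq_mul]
    rw [Finset.sum_mul_sum, ← Finset.sum_product']
    refine Finset.sum_congr rfl fun y _ ↦ ?_
    ring

/-- `∑_{k=1}^j k^{-s}`. -/
noncomputable def harmonicSum (s j : ℕ) : ℝ := ∑ i ∈ Finset.range j, 1 / (i + 1 : ℝ) ^ s

lemma lcmUpto_pow_mul_harmonicSum {n j : ℕ} (s : ℕ) (hj : j ≤ n) :
    ∃ z : ℤ, (Nat.lcmUpto n : ℝ) ^ s * harmonicSum s j = z := by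
  have key (i : ℕ) (hi : i ∈ Finset.range j) :
      (Nat.lcmUpto n : ℝ) ^ s * (1 / (i + 1 : ℝ) ^ s) = ((Nat.lcmUpto n / (i + 1) : ℕ) : ℝ) ^ s := by
    rw [Finset.mem_range] at hi
    have : i + 1 ∣ Nat.lcmUpto n := dvd_lcmUpto (by omega) (by omega)
    rw [Nat.cast_div this (by positivity), div_pow]
    push_cast
    ring
  refine ⟨∑ i ∈ Finset.range j, ((Nat.lcmUpto n / (i + 1) : ℕ) : ℤ) ^ s, ?_⟩
  rw [harmonicSum, Finset.mul_sum, Finset.sum_congr rfl key]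
  push_cast
  rfl

lemma hasSum_zetaR_shift {s : ℕ} (hs : 2 ≤ s) (j : ℕ) :
    HasSum (fun k : ℕ ↦ 1 / ((k : ℝ) + 1 + j) ^ s) (zetaR s - harmonicSum s j) := by
  have h : Summable fun k : ℕ ↦ 1 / ((k : ℝ) + 1) ^ s := by
    have := (summable_nat_add_iff 1).2 (Real.summable_one_div_nat_pow.2 (by omega : 1 < s))
    simpa using this
  have h1 := (hasSum_nat_add_iff' j).2 h.hasSum
  have h2 (k : ℕ) : 1 / ((k : ℝ) + 1 + j) ^ s = 1 / (((k + j : ℕ) : ℝ) + 1) ^ s := by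
    push_cast
    ring_nf
  simp only [h2]
  exact h1

lemma hasSum_one_div_sub_shift (j : ℕ) :
    HasSum (fun k : ℕ ↦ 1 / ((k : ℝ) + 1 + j) - 1 / ((k : ℝ) + 1)) (-harmonicSum 1 j) := by
  induction j with
  | zero => simp [harmonicSum]
  | succ j ih =>
    have h1 : HasSum (fun k : ℕ ↦ 1 / ((k : ℝ) + 1 + j) - 1 / (((k + 1 : ℕ) : ℝ) + 1 + j))
        (1 / (j + 1 : ℝ)) := by
      rw [hasSum_iff_tendsto_nat_of_nonneg]
      · simp only [Finset.sum_range_sub' fun k : ℕ ↦ 1 / ((k : ℝ) + 1 + j)]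
        have h2 : Tendsto (fun k : ℕ ↦ 1 / ((k : ℝ) + 1 + j)) atTop (𝓝 0) := by
          simp only [one_div]
          refine tendsto_inv_atTop_zero.comp ?_
          simp only [add_assoc]
          exact tendsto_atTop_add_const_right _ _ tendsto_natCast_atTop_atTop
        convert tendsto_const_nhds.sub h2 using 2
        simp [add_comm]
      · intro k
        rw [sub_nonneg]
        push_cast
        gcongr
        linarith
    have h2 : -harmonicSum 1 (j + 1) = -harmonicSum 1 j - 1 / (j + 1 : ℝ) := by
      simp only [harmonicSum, Finset.sum_range_succ, pow_one]
      ring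
    have h3 (k : ℕ) : 1 / ((k : ℝ) + 1 + (j + 1 : ℕ)) - 1 / ((k : ℝ) + 1) =
        1 / ((k : ℝ) + 1 + j) - 1 / ((k : ℝ) + 1) -
          (1 / ((k : ℝ) + 1 + j) - 1 / (((k + 1 : ℕ) : ℝ) + 1 + j)) := by
      push_cast
      ring
    simp only [h2, h3]
    exact ih.sub h1

lemma tendsto_mul_div_add_pow (u : ℝ) (l j : ℕ) :
    Tendsto (fun t : ℝ ↦ t * (u / (t + j) ^ (l + 1))) atTop (𝓝 (if l = 0 then u else 0)) := by
  have hadd : Tendsto (fun t : ℝ ↦ t + j) atTop atTop :=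
    tendsto_atTop_add_const_right _ _ tendsto_id
  have hinv : Tendsto (fun t : ℝ ↦ (t + j)⁻¹) atTop (𝓝 0) := tendsto_inv_atTop_zero.comp hadd
  have h1 : Tendsto (fun t : ℝ ↦ t * (t + j)⁻¹) atTop (𝓝 1) := by
    have h2 : Tendsto (fun t : ℝ ↦ 1 - j * (t + j)⁻¹) atTop (𝓝 (1 - j * 0)) :=
      tendsto_const_nhds.sub (hinv.const_mul _)
    rw [mul_zero, sub_zero] at h2
    refine h2.congr' ?_
    filter_upwards [eventually_gt_atTop 0] with t ht
    have : t + j ≠ 0 := by positivity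
    field_simp
    ring
  have h3 := (h1.mul (hinv.pow l)).const_mul u
  have h4 : u * (1 * 0 ^ l) = if l = 0 then u else 0 := by
    split_ifs with h <;> simp [h]
  rw [h4] at h3
  refine h3.congr fun t ↦ ?_
  rw [pow_succ, div_eq_mul_inv, mul_inv, inv_pow]
  ring

/-- Summing an antisymmetric combination of partial fractions over the positive integers yields
a linear form in `1` and the odd zeta values, with controlled integral coefficients. -/
theorem HasPartialFraction.exists_linear_form {n M : ℕ} {B : ℝ} {R : ℝ → ℝ}
    (hR : HasPartialFraction n M M B R) (hanti : ∀ t : ℝ, 0 < t → R (-n - t) = -R t)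
    (htend : Tendsto (fun t : ℝ ↦ t * R t) atTop (𝓝 0)) :
    ∃ (p₀ : ℤ) (p : ℕ → ℤ),
      HasSum (fun k : ℕ ↦ (Nat.lcmUpto n : ℝ) ^ M * (2 * R (k + 1)))
        (p₀ + ∑ l ∈ Finset.range M with Even l ∧ l ≠ 0, p l * zetaR (l + 1)) ∧
      ∀ l < M, |(p l : ℝ)| ≤ (Nat.lcmUpto n : ℝ) ^ M * (2 * B) := by
  obtain ⟨c, h1, -, h3, h4⟩ := hR
  set d : ℝ := (Nat.lcmUpto n : ℝ) with hd
  set T := Finset.range M ×ˢ Finset.range (n + 1) with hT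
  let c' : ℕ × ℕ → ℝ := fun x ↦ c x + (-1) ^ x.1 * c (x.1, n - x.2)
  let A : ℕ → ℝ := fun l ↦ ∑ j ∈ Finset.range (n + 1), c' (l, j)
  have hrefl (φ : ℕ → ℝ) :
      ∑ j ∈ Finset.range (n + 1), φ (n - j) = ∑ j ∈ Finset.range (n + 1), φ j := by
    simpa using Finset.sum_range_reflect φ (n + 1)
  have hreflT (φ : ℕ × ℕ → ℝ) : ∑ x ∈ T, φ (x.1, n - x.2) = ∑ x ∈ T, φ x := by
    rw [hT, Finset.sum_product, Finset.sum_product]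
    exact Finset.sum_congr rfl fun l _ ↦ hrefl fun j ↦ φ (l, j)
  have h2R (t : ℝ) (ht : 0 < t) : 2 * R t = ∑ x ∈ T, c' x / (t + x.2) ^ (x.1 + 1) := by
    have e1 := h1 t fun j _ ↦ by positivity
    have e2 := h1 (-n - t) fun j hj ↦ by
      have : (j : ℝ) ≤ n := by exact_mod_cast hj
      linarith
    rw [hanti t ht, ← hreflT] at e2
    have e3 : R t = ∑ x ∈ T, (-1) ^ x.1 * c (x.1, n - x.2) / (t + x.2) ^ (x.1 + 1) := by
      rw [← neg_neg (R t), e2, ← Finset.sum_neg_distrib]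
      refine Finset.sum_congr rfl fun x hx ↦ ?_
      simp only [hT, Finset.mem_product, Finset.mem_range] at hx
      have e4 : -(n : ℝ) - t + ((n - x.2 : ℕ) : ℝ) = -1 * (t + x.2) := by
        rw [Nat.cast_sub (by omega)]
        ring
      rw [e4, mul_pow, pow_succ (-1 : ℝ)]
      generalize (t + (x.2 : ℝ)) ^ (x.1 + 1) = y
      rcases neg_one_pow_eq_or ℝ x.1 with h | h <;> rw [h] <;> ring
    rw [two_mul]
    nth_rewrite 1 [e1]
    rw [e3, ← Finset.sum_add_distrib]
    exact Finset.sum_congr rfl fun x _ ↦ by rw [← add_div]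
  have hAodd (l : ℕ) (hl : ¬ Even l) : A l = 0 := by
    have h : (-1 : ℝ) ^ l = -1 := (Nat.not_even_iff_odd.1 hl).neg_one_pow
    simp only [A, c', h, Finset.sum_add_distrib, ← Finset.mul_sum]
    rw [hrefl fun j ↦ c (l, j)]
    ring
  have hA0 (hM : 0 < M) : A 0 = 0 := by
    have e1 : Tendsto (fun t : ℝ ↦ t * (2 * R t)) atTop (𝓝 0) := by
      have := htend.const_mul 2
      rw [mul_zero] at this
      exact this.congr fun t ↦ by ring
    have e2 : Tendsto (fun t : ℝ ↦ t * (2 * R t)) atTop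
        (𝓝 (∑ x ∈ T, if x.1 = 0 then c' x else 0)) := by
      have := tendsto_finsetSum T fun x _ ↦ tendsto_mul_div_add_pow (c' x) x.1 x.2
      refine this.congr' ?_
      filter_upwards [eventually_gt_atTop 0] with t ht
      rw [h2R t ht, Finset.mul_sum]
    have e3 := tendsto_nhds_unique e2 e1
    rw [hT, Finset.sum_product, Finset.sum_eq_single_of_mem 0 (Finset.mem_range.2 hM)] at e3
    · simpa using e3
    · intro l _ hl
      simp [hl]
  let w : ℕ → ℝ := fun l ↦ if l = 0 then 0 else zetaR (l + 1)
  let u : ℕ → ℕ → ℝ := fun l k ↦ if l = 0 then 1 / ((k : ℝ) + 1) else 0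
  have hsum1 (l j : ℕ) : HasSum (fun k : ℕ ↦ 1 / ((k : ℝ) + 1 + j) ^ (l + 1) - u l k)
      (w l - harmonicSum (l + 1) j) := by
    by_cases hl : l = 0
    · subst hl
      simpa [w, u] using hasSum_one_div_sub_shift j
    · simpa [w, u, hl] using hasSum_zetaR_shift (by omega) j
  have hsum2 := hasSum_sum fun x (_ : x ∈ T) ↦ (hsum1 x.1 x.2).mul_left (c' x)
  have hterm (k : ℕ) : ∑ x ∈ T, c' x * (1 / ((k : ℝ) + 1 + x.2) ^ (x.1 + 1) - u x.1 k) =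
      2 * R (k + 1) := by
    have e1 : ∑ x ∈ T, c' x * u x.1 k = 0 := by
      rw [hT, Finset.sum_product]
      refine Finset.sum_eq_zero fun l hl ↦ ?_
      simp only [← Finset.sum_mul]
      by_cases h0 : l = 0
      · subst h0
        have := hA0 (by simp at hl; omega)
        simp only [A] at this
        rw [this, zero_mul]
      · simp [u, h0]
    simp only [mul_sub, Finset.sum_sub_distrib, e1, sub_zero, mul_one_div]
    exact (h2R _ (by positivity)).symm
  have hval : ∑ x ∈ T, c' x * (w x.1 - harmonicSum (x.1 + 1) x.2) =
      - ∑ x ∈ T, c' x * harmonicSum (x.1 + 1) x.2 +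
        ∑ l ∈ Finset.range M with Even l ∧ l ≠ 0, A l * zetaR (l + 1) := by
    simp only [mul_sub, Finset.sum_sub_distrib]
    rw [sub_eq_neg_add]
    congr 1
    rw [hT, Finset.sum_product, Finset.sum_filter]
    refine Finset.sum_congr rfl fun l _ ↦ ?_
    simp only [← Finset.sum_mul]
    change A l * w l = _
    by_cases h0 : l = 0
    · simp [w, h0]
    · by_cases he : Even l
      · simp [w, h0, he]
      · simp [hAodd l he]
  have hcint (x : ℕ × ℕ) : ∃ z : ℤ, d ^ (M - 1 - x.1) * c' x = z := by
    obtain ⟨z, hz⟩ := h3 x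
    obtain ⟨z', hz'⟩ := h3 (x.1, n - x.2)
    refine ⟨z + (-1) ^ x.1 * z', ?_⟩
    push_cast
    rw [← hz, ← hz']
    simp only [c']
    ring
  have hpint (l : ℕ) : ∃ z : ℤ, d ^ M * A l = z := by
    choose z hz using fun j ↦ hcint (l, j)
    refine ⟨(Nat.lcmUpto n : ℤ) ^ (M - (M - 1 - l)) * ∑ j ∈ Finset.range (n + 1), z j, ?_⟩
    push_cast
    rw [← Finset.sum_congr rfl fun j _ ↦ hz j]
    simp only
    rw [← Finset.mul_sum, ← hd, ← mul_assoc, ← pow_add,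
      Nat.sub_add_cancel (by omega)]
  have hp0int : ∃ z : ℤ, d ^ M * -∑ x ∈ T, c' x * harmonicSum (x.1 + 1) x.2 = z := by
    have e (x) (hx : x ∈ T) : ∃ z : ℤ, d ^ M * (c' x * harmonicSum (x.1 + 1) x.2) = z := by
      simp only [hT, Finset.mem_product, Finset.mem_range] at hx
      obtain ⟨z, hz⟩ := hcint x
      obtain ⟨z', hz'⟩ := lcmUpto_pow_mul_harmonicSum (n := n) (j := x.2) (x.1 + 1) (by omega)
      refine ⟨z * z', ?_⟩
      have : M = (M - 1 - x.1) + (x.1 + 1) := by omega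
      push_cast
      rw [← hz, ← hz', ← hd]
      nth_rewrite 1 [this]
      rw [pow_add]
      ring
    choose! z hz using e
    refine ⟨-∑ x ∈ T, z x, ?_⟩
    push_cast
    rw [mul_neg, Finset.mul_sum, Finset.sum_congr rfl hz]
  obtain ⟨p₀, hp₀⟩ := hp0int
  choose p hp using hpint
  refine ⟨p₀, p, ?_, fun l hl ↦ ?_⟩
  · have := hsum2.mul_left (d ^ M)
    simp only [hterm, hval] at this
    rw [mul_add, hp₀, Finset.mul_sum] at this
    simpa only [← mul_assoc, hp] using this
  · rw [← hp, abs_mul, abs_of_nonneg (by positivity)]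
    refine mul_le_mul_of_nonneg_left ?_ (by positivity)
    calc |A l| ≤ ∑ j ∈ Finset.range (n + 1), |c' (l, j)| := Finset.abs_sum_le_sum_abs _ _
      _ ≤ ∑ l ∈ Finset.range M, ∑ j ∈ Finset.range (n + 1), |c' (l, j)| :=
          Finset.single_le_sum (f := fun l ↦ ∑ j ∈ Finset.range (n + 1), |c' (l, j)|)
            (fun _ _ ↦ Finset.sum_nonneg fun _ _ ↦ abs_nonneg _) (Finset.mem_range.2 hl)
      _ = ∑ x ∈ T, |c' x| := by rw [hT, Finset.sum_product]
      _ ≤ ∑ x ∈ T, (|c x| + |c (x.1, n - x.2)|) := by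
          refine Finset.sum_le_sum fun x _ ↦ (abs_add_le _ _).trans_eq ?_
          rw [abs_mul, abs_neg_one_pow, one_mul]
      _ ≤ 2 * B := by
          rw [Finset.sum_add_distrib, hreflT fun x ↦ |c x|]
          linarith

lemma prod_erase_sub {n i : ℕ} (hi : i ≤ n) :
    ∏ j ∈ (Finset.range (n + 1)).erase i, ((j : ℝ) - i) =
      (-1) ^ i * (i.factorial * (n - i).factorial) := by
  obtain ⟨m, rfl⟩ := Nat.exists_eq_add_of_le hi
  have h1 : ∏ j ∈ (Finset.range (i + m + 1)).erase i, ((j : ℝ) - i) =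
      ∏ j ∈ Finset.range (i + 1 + m), if j = i then 1 else ((j : ℝ) - i) := by
    rw [show i + m + 1 = i + 1 + m by ring,
      ← Finset.mul_prod_erase (Finset.range (i + 1 + m)) _ (a := i)
        (by simp only [Finset.mem_range]; omega), if_pos rfl, one_mul]
    exact Finset.prod_congr rfl fun j hj ↦ by rw [if_neg (Finset.ne_of_mem_erase hj)]
  rw [h1, Finset.prod_range_add, Finset.prod_range_succ, if_pos rfl, mul_one, ← mul_assoc]
  congr 1
  · rw [← Finset.prod_range_reflect, ← Finset.prod_range_add_one_eq_factorial]
    push_cast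
    rw [show (-1 : ℝ) ^ i = ∏ _j ∈ Finset.range i, (-1 : ℝ) by simp, ← Finset.prod_mul_distrib]
    refine Finset.prod_congr rfl fun j hj ↦ ?_
    rw [Finset.mem_range] at hj
    rw [if_neg (by omega), Nat.sub_sub, Nat.cast_sub (by omega)]
    push_cast
    ring
  · rw [Nat.add_sub_cancel_left, ← Finset.prod_range_add_one_eq_factorial]
    push_cast
    refine Finset.prod_congr rfl fun j hj ↦ ?_
    rw [if_neg (by omega)]
    ring

/-- Partial fractions of `P / (t (t + 1) ⋯ (t + n))` by Lagrange interpolation. -/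
lemma hasSimpleFraction_of_eval {n : ℕ} {Z : ℝ} (P : Polynomial ℝ) (hP : P.natDegree ≤ n)
    (h : ∀ p ≤ n, ∃ z : ℤ, P.eval (-(p : ℝ)) = n.factorial * z ∧ |(z : ℝ)| ≤ Z) :
    HasSimpleFraction n (Z * 2 ^ n)
      fun t ↦ P.eval t / ∏ j ∈ Finset.range (n + 1), (t + j) := by
  choose! z hz hZ using h
  refine ⟨fun p ↦ (-1) ^ p * (n.choose p) * z p, fun t ht ↦ ?_, ?_⟩
  · have hinj : Set.InjOn (fun j : ℕ ↦ -(j : ℝ)) (Finset.range (n + 1)) :=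
      fun a _ b _ hab ↦ by simpa using hab
    have hdeg : P.degree < (Finset.range (n + 1)).card := by
      rw [Finset.card_range]
      exact Polynomial.degree_le_natDegree.trans_lt (by exact_mod_cast Nat.lt_succ_of_le hP)
    have hne (j : ℕ) (hj : j ∈ Finset.range (n + 1)) : t ≠ -(j : ℝ) := fun h0 ↦
      ht j (by simp at hj; omega) (by rw [h0]; ring)
    have hprod : ∏ j ∈ Finset.range (n + 1), (t + j) ≠ 0 :=
      Finset.prod_ne_zero_iff.2 fun j hj ↦ ht j (by simp at hj; omega)
    have e := Lagrange.eval_interpolate_not_at_node (s := Finset.range (n + 1))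
      (v := fun j : ℕ ↦ -(j : ℝ)) (fun j ↦ P.eval (-(j : ℝ))) hne
    rw [← Lagrange.eq_interpolate hinj hdeg, Lagrange.eval_nodal] at e
    simp only [sub_neg_eq_add] at e
    simp only
    rw [e, mul_div_cancel_left₀ _ hprod]
    refine Finset.sum_congr rfl fun p hp ↦ ?_
    have hp' : p ≤ n := by simp at hp; omega
    have hw : Lagrange.nodalWeight (Finset.range (n + 1)) (fun j : ℕ ↦ -(j : ℝ)) p =
        (-1) ^ p * n.choose p / n.factorial := by
      rw [Lagrange.nodalWeight, Finset.prod_inv_distrib]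
      simp only [neg_sub_neg]
      rw [prod_erase_sub hp', Nat.cast_choose ℝ hp', mul_inv, ← inv_pow, inv_neg, inv_one]
      field_simp
    rw [hw, hz p hp']
    push_cast
    field_simp
  · calc _ ≤ ∑ p ∈ Finset.range (n + 1), (n.choose p : ℝ) * Z := by
          refine Finset.sum_le_sum fun p hp ↦ ?_
          push_cast
          rw [abs_mul, abs_mul, abs_neg_one_pow, one_mul, Nat.abs_cast]
          gcongr
          exact hZ p (by simp at hp; omega)
      _ = _ := by
          rw [← Finset.sum_mul, mul_comm]
          congr 1
          exact_mod_cast Nat.sum_range_choose n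

lemma prod_range_add_eq_choose (q n : ℕ) :
    ∏ k ∈ Finset.range n, ((q : ℝ) + 1 + k) = n.factorial * (q + n).choose n := by
  have := Nat.ascFactorial_eq_factorial_mul_choose q n
  rw [Nat.ascFactorial_eq_prod_range] at this
  exact_mod_cast this

lemma choose_le_three_mul_pow {q r n : ℕ} (h : q + n ≤ (r + 1) * n) :
    ((q + n).choose n : ℝ) ≤ (3 * (r + 1)) ^ n := by
  calc ((q + n).choose n : ℝ) ≤ ((q + n : ℕ) : ℝ) ^ n / n.factorial := Nat.choose_le_pow_div _ _
    _ ≤ (((r + 1) * n : ℕ) : ℝ) ^ n / n.factorial := by gcongr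
    _ = (r + 1) ^ n * ((n : ℝ) ^ n / n.factorial) := by
        push_cast
        rw [mul_pow, mul_div_assoc]
    _ ≤ (r + 1) ^ n * Real.exp n := by
        gcongr
        exact Real.pow_div_factorial_le_exp _ (Nat.cast_nonneg n) n
    _ ≤ (r + 1) ^ n * 3 ^ n := by
        gcongr
        rw [← mul_one (n : ℝ), Real.exp_nat_mul]
        gcongr
        exact Real.exp_one_lt_three.le
    _ = _ := by rw [← mul_pow]; ring

/-- The simple fraction `∏_{k=1}^{n} (t - i n - k) / (t (t + 1) ⋯ (t + n))`. -/
noncomputable def brLeft (n i : ℕ) (t : ℝ) : ℝ :=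
  (∏ k ∈ Finset.range n, (t - (i * n + 1 + k))) / ∏ j ∈ Finset.range (n + 1), (t + j)

/-- The simple fraction `∏_{k=1}^{n} (t + n + i n + k) / (t (t + 1) ⋯ (t + n))`. -/
noncomputable def brRight (n i : ℕ) (t : ℝ) : ℝ :=
  (∏ k ∈ Finset.range n, (t + n + (i * n + 1 + k))) / ∏ j ∈ Finset.range (n + 1), (t + j)

/-- The simple fraction `n! / (t (t + 1) ⋯ (t + n))`. -/
noncomputable def brUnit (n : ℕ) (t : ℝ) : ℝ :=
  n.factorial / ∏ j ∈ Finset.range (n + 1), (t + j)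

lemma hasSimpleFraction_brUnit (n : ℕ) : HasSimpleFraction n (2 ^ n) (brUnit n) := by
  have := hasSimpleFraction_of_eval (n := n) (Z := 1) (Polynomial.C (n.factorial : ℝ)) (by simp)
    fun p _ ↦ ⟨1, by simp⟩
  rw [one_mul] at this
  simp only [Polynomial.eval_C] at this
  exact this

lemma hasSimpleFraction_brLeft {n i r : ℕ} (hi : i < r) :
    HasSimpleFraction n ((3 * (r + 1)) ^ n * 2 ^ n) (brLeft n i) := by
  have h0 : ∀ t : ℝ, (∏ k ∈ Finset.range n, (Polynomial.X -
      Polynomial.C (i * n + 1 + k : ℝ))).eval t = ∏ k ∈ Finset.range n, (t - (i * n + 1 + k)) :=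
    fun t ↦ by simp [Polynomial.eval_prod]
  have := hasSimpleFraction_of_eval (n := n) (Z := (3 * (r + 1)) ^ n)
    (∏ k ∈ Finset.range n, (Polynomial.X - Polynomial.C (i * n + 1 + k : ℝ)))
    (by rw [Polynomial.natDegree_finsetProd_X_sub_C_eq_card]; simp) fun p hp ↦
      ⟨(-1) ^ n * (p + i * n + n).choose n, ?_, ?_⟩
  · simp only [h0] at this
    exact this
  · rw [h0]
    have := prod_range_add_eq_choose (p + i * n) n
    push_cast
    rw [mul_left_comm, ← this]
    rw [show (-1 : ℝ) ^ n = ∏ _k ∈ Finset.range n, (-1 : ℝ) by simp, ← Finset.prod_mul_distrib]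
    refine Finset.prod_congr rfl fun k _ ↦ ?_
    push_cast
    ring
  · push_cast
    rw [abs_mul, abs_neg_one_pow, one_mul, Nat.abs_cast]
    refine choose_le_three_mul_pow ?_
    nlinarith

lemma hasSimpleFraction_brRight {n i r : ℕ} (hi : i < r) :
    HasSimpleFraction n ((3 * (r + 1)) ^ n * 2 ^ n) (brRight n i) := by
  have h0 : ∀ t : ℝ, (∏ k ∈ Finset.range n, (Polynomial.X -
      Polynomial.C (-(n + (i * n + 1 + k)) : ℝ))).eval t =
        ∏ k ∈ Finset.range n, (t + n + (i * n + 1 + k)) :=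
    fun t ↦ by simp only [Polynomial.eval_prod, Polynomial.eval_sub, Polynomial.eval_X,
      Polynomial.eval_C, sub_neg_eq_add, add_assoc]
  have := hasSimpleFraction_of_eval (n := n) (Z := (3 * (r + 1)) ^ n)
    (∏ k ∈ Finset.range n, (Polynomial.X - Polynomial.C (-(n + (i * n + 1 + k)) : ℝ)))
    (by rw [Polynomial.natDegree_finsetProd_X_sub_C_eq_card]; simp) fun p hp ↦
      ⟨((n - p) + i * n + n).choose n, ?_, ?_⟩
  · simp only [h0] at this
    exact this
  · rw [h0]
    have := prod_range_add_eq_choose ((n - p) + i * n) n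
    rw [Int.cast_natCast, ← this]
    refine Finset.prod_congr rfl fun k _ ↦ ?_
    rw [Nat.cast_add, Nat.cast_sub hp]
    push_cast
    ring
  · rw [Int.cast_natCast, Nat.abs_cast]
    refine choose_le_three_mul_pow ?_
    have : n - p ≤ n := Nat.sub_le _ _
    nlinarith

/-- The Ball–Rivoal rational function
`n! ^ (a - 2r) * ∏_{k=1}^{rn} (t - k) (t + n + k) / (t (t + 1) ⋯ (t + n)) ^ a`. -/
noncomputable def brFun (a r n : ℕ) (t : ℝ) : ℝ :=
  brUnit n t ^ (a - 2 * r) * ∏ i ∈ Finset.range r, (brLeft n i t * brRight n i t)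

lemma HasPartialFraction.mul_factorial {n M d : ℕ} {X B' : ℝ} {f g : ℝ → ℝ} (hd : d < M)
    (hf : HasPartialFraction n M d (d.factorial * X) f) (hg : HasSimpleFraction n B' g) :
    HasPartialFraction n M (d + 1) ((d + 1).factorial * (X * B')) (f * g) := by
  refine (hf.mul hd hg).mono (le_of_eq ?_)
  rw [Nat.factorial_succ]
  push_cast
  ring

lemma hasPartialFraction_brUnit_pow {n M e : ℕ} (he : e < M) :
    HasPartialFraction n M (e + 1) ((e + 1).factorial * (2 ^ n) ^ (e + 1)) (brUnit n ^ (e + 1)) := by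
  induction e with
  | zero =>
    simpa using (hasSimpleFraction_brUnit n).hasPartialFraction he
  | succ e ih =>
    have := (ih (by omega)).mul_factorial (by omega) (hasSimpleFraction_brUnit n)
    rwa [← pow_succ, ← pow_succ] at this

lemma hasPartialFraction_brFun {a r : ℕ} (har : 2 * r < a) (n : ℕ) :
    HasPartialFraction n a a (a.factorial * ((2 ^ n) ^ a * ((3 * (r + 1)) ^ n) ^ (2 * r)))
      (brFun a r n) := by
  obtain ⟨e, he⟩ := Nat.exists_eq_add_of_lt har
  have key (s : ℕ) (hs : s ≤ r) : HasPartialFraction n a (e + 1 + 2 * s)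
      ((e + 1 + 2 * s).factorial * ((2 ^ n) ^ (e + 1 + 2 * s) * ((3 * (r + 1)) ^ n) ^ (2 * s)))
      (fun t ↦ brUnit n t ^ (e + 1) * ∏ i ∈ Finset.range s, (brLeft n i t * brRight n i t)) := by
    induction s with
    | zero =>
      simp only [mul_zero, add_zero, Finset.range_zero, Finset.prod_empty, pow_zero, mul_one]
      exact hasPartialFraction_brUnit_pow (by omega)
    | succ s ih =>
      have := ((ih (by omega)).mul_factorial (by omega)
        (hasSimpleFraction_brLeft (by omega : s < r))).mul_factorial (by omega)
        (hasSimpleFraction_brRight (by omega : s < r))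
      refine (this.mono (le_of_eq ?_)).congr fun t _ ↦ ?_
      · rw [show e + 1 + 2 * (s + 1) = e + 1 + 2 * s + 1 + 1 by ring]
        ring
      · simp only [Pi.mul_apply, Finset.prod_range_succ]
        ring
  have := key r le_rfl
  rw [show e + 1 + 2 * r = a by omega, show e + 1 = a - 2 * r by omega] at this
  exact this

lemma HasSimpleFraction.tendsto_mul {n : ℕ} {B : ℝ} {g : ℝ → ℝ} (h : HasSimpleFraction n B g) :
    ∃ u : ℝ, Tendsto (fun t ↦ t * g t) atTop (𝓝 u) := by
  obtain ⟨z, hz, -⟩ := h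
  refine ⟨_, (tendsto_finsetSum (Finset.range (n + 1)) fun p _ ↦
    tendsto_mul_div_add_pow (z p) 0 p).congr' ?_⟩
  filter_upwards [eventually_gt_atTop 0] with t ht
  rw [hz t fun j _ ↦ by positivity, Finset.mul_sum]
  simp

lemma HasSimpleFraction.tendsto_zero {n : ℕ} {B : ℝ} {g : ℝ → ℝ} (h : HasSimpleFraction n B g) :
    Tendsto g atTop (𝓝 0) := by
  obtain ⟨u, hu⟩ := h.tendsto_mul
  have := tendsto_inv_atTop_zero.mul hu
  rw [zero_mul] at this
  refine this.congr' ?_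
  filter_upwards [eventually_gt_atTop 0] with t ht
  field_simp

lemma tendsto_mul_brFun {a r : ℕ} (har : 2 * r < a) (hr : 0 < r) (n : ℕ) :
    Tendsto (fun t ↦ t * brFun a r n t) atTop (𝓝 0) := by
  obtain ⟨e, he⟩ := Nat.exists_eq_add_of_lt har
  obtain ⟨u, hu⟩ := (hasSimpleFraction_brUnit n).tendsto_mul
  have h1 := tendsto_finsetProd (Finset.range r) fun i hi ↦
    (hasSimpleFraction_brLeft (n := n) (Finset.mem_range.1 hi)).tendsto_zero.mul
      (hasSimpleFraction_brRight (n := n) (Finset.mem_range.1 hi)).tendsto_zero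
  rw [Finset.prod_eq_zero (Finset.mem_range.2 hr) (by simp)] at h1
  have h2 := hu.mul (((hasSimpleFraction_brUnit n).tendsto_zero.pow e).mul h1)
  rw [mul_zero, mul_zero] at h2
  refine h2.congr fun t ↦ ?_
  rw [brFun, show a - 2 * r = e + 1 by omega]
  ring

lemma prod_neg_sub_add (n : ℕ) (t : ℝ) :
    ∏ j ∈ Finset.range (n + 1), (-(n : ℝ) - t + j) =
      (-1) ^ (n + 1) * ∏ j ∈ Finset.range (n + 1), (t + j) := by
  rw [← Finset.prod_range_reflect,
    show (-1 : ℝ) ^ (n + 1) = ∏ _j ∈ Finset.range (n + 1), (-1 : ℝ) by simp,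
    ← Finset.prod_mul_distrib]
  refine Finset.prod_congr rfl fun j hj ↦ ?_
  rw [Finset.mem_range] at hj
  rw [show n + 1 - 1 - j = n - j by omega, Nat.cast_sub (by omega)]
  ring

lemma brUnit_neg {n : ℕ} (hn : Even n) (t : ℝ) : brUnit n (-n - t) = -brUnit n t := by
  rw [brUnit, brUnit, prod_neg_sub_add, hn.add_one.neg_one_pow, neg_one_mul, div_neg]

lemma brLeft_neg {n : ℕ} (hn : Even n) (i : ℕ) (t : ℝ) :
    brLeft n i (-n - t) = -brRight n i t := by
  rw [brLeft, brRight, prod_neg_sub_add, hn.add_one.neg_one_pow, neg_one_mul, div_neg]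
  have : ∏ k ∈ Finset.range n, (-(n : ℝ) - t - (i * n + 1 + k)) =
      (-1) ^ n * ∏ k ∈ Finset.range n, (t + n + (i * n + 1 + k)) := by
    rw [show (-1 : ℝ) ^ n = ∏ _k ∈ Finset.range n, (-1 : ℝ) by simp, ← Finset.prod_mul_distrib]
    exact Finset.prod_congr rfl fun k _ ↦ by ring
  rw [this, hn.neg_one_pow, one_mul]

lemma brRight_neg {n : ℕ} (hn : Even n) (i : ℕ) (t : ℝ) :
    brRight n i (-n - t) = -brLeft n i t := by
  have := brLeft_neg hn i (-n - t)
  rw [sub_sub_cancel] at this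
  rw [this, neg_neg]

lemma brFun_neg {a r n : ℕ} (ha : Odd a) (har : 2 * r < a) (hn : Even n) (t : ℝ) :
    brFun a r n (-n - t) = -brFun a r n t := by
  have h : Odd (a - 2 * r) := Nat.Odd.sub_even har.le ha (even_two_mul r)
  simp only [brFun, brUnit_neg hn, brLeft_neg hn, brRight_neg hn, h.neg_pow, neg_mul]
  congr 2
  exact Finset.prod_congr rfl fun i _ ↦ by ring

lemma brFun_eq_zero {a r n k : ℕ} (hk : k < r * n) : brFun a r n (k + 1) = 0 := by
  have hn : 0 < n := by
    rcases n with _ | n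
    · simp at hk
    · omega
  refine mul_eq_zero_of_right _ (Finset.prod_eq_zero (i := k / n)
    (Finset.mem_range.2 ((Nat.div_lt_iff_lt_mul hn).2 hk)) (mul_eq_zero_of_left ?_ _))
  rw [brLeft, Finset.prod_eq_zero (i := k % n) (Finset.mem_range.2 (Nat.mod_lt _ hn)), zero_div]
  have : (k : ℝ) = ((k / n * n + k % n : ℕ) : ℝ) := by rw [Nat.div_add_mod']
  rw [this]
  push_cast
  ring

/-- The `n`-th linear form in odd zeta values. -/
theorem exists_linear_form_brFun {a r n : ℕ} (ha : Odd a) (har : 2 * r < a) (hr : 0 < r)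
    (hn : Even n) :
    ∃ (p₀ : ℤ) (p : ℕ → ℤ),
      HasSum (fun k : ℕ ↦ (Nat.lcmUpto n : ℝ) ^ a * (2 * brFun a r n (k + 1)))
        (p₀ + ∑ l ∈ Finset.range a with Even l ∧ l ≠ 0, p l * zetaR (l + 1)) ∧
      ∀ l < a, |(p l : ℝ)| ≤ (Nat.lcmUpto n : ℝ) ^ a *
        (2 * (a.factorial * ((2 ^ n) ^ a * ((3 * (r + 1)) ^ n) ^ (2 * r)))) :=
  (hasPartialFraction_brFun har n).exists_linear_form (fun t _ ↦ brFun_neg ha har hn t)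
    (tendsto_mul_brFun har hr n)

lemma factorial_le_pow_mul_exp (n : ℕ) :
    ((n + 1).factorial : ℝ) ≤ (n + 1) ^ (n + 2) * Real.exp (-n) := by
  induction n with
  | zero => simp
  | succ n ih =>
    have h1 : Real.exp 1 * (n + 1) ^ (n + 2) ≤ ((n : ℝ) + 2) ^ (n + 2) := by
      have h2 := Real.one_sub_le_exp_neg (1 / ((n : ℝ) + 2))
      have h3 : (1 - 1 / ((n : ℝ) + 2)) = (n + 1) / (n + 2) := by field_simp; ring
      rw [h3, div_le_iff₀ (by positivity)] at h2
      calc Real.exp 1 * (n + 1) ^ (n + 2)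
          ≤ Real.exp 1 * (Real.exp (-(1 / ((n : ℝ) + 2))) * (n + 2)) ^ (n + 2) := by gcongr
        _ = Real.exp 1 * Real.exp (-1) * ((n : ℝ) + 2) ^ (n + 2) := by
            rw [mul_pow, ← Real.exp_nat_mul, mul_assoc]
            congr 3
            push_cast
            field_simp
        _ = _ := by rw [← Real.exp_add]; simp
    rw [Nat.factorial_succ]
    push_cast
    calc ((n : ℝ) + 1 + 1) * (n + 1).factorial
        ≤ (n + 1 + 1) * ((n + 1) ^ (n + 2) * Real.exp (-n)) := by gcongr
      _ = (n + 1 + 1) * (Real.exp 1 * (n + 1) ^ (n + 2)) * Real.exp (-(n + 1)) := by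
          rw [neg_add, Real.exp_add, Real.exp_neg 1]
          field_simp
      _ ≤ (n + 1 + 1) * ((n + 2) ^ (n + 2)) * Real.exp (-(n + 1)) := by gcongr
      _ = _ := by ring

lemma factorial_div_pow_le {n : ℕ} (hn : 0 < n) :
    (n.factorial : ℝ) / n ^ n ≤ Real.exp 1 * n * Real.exp (-n) := by
  obtain ⟨m, rfl⟩ : ∃ m, n = m + 1 := ⟨n - 1, by omega⟩
  rw [div_le_iff₀ (by positivity)]
  refine (factorial_le_pow_mul_exp m).trans_eq ?_
  push_cast
  have : Real.exp (-(m : ℝ)) = Real.exp 1 * Real.exp (-(m + 1)) := by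
    rw [← Real.exp_add]; ring_nf
  rw [this]
  ring

section bounds

variable {n i r : ℕ} {t : ℝ}

lemma pow_le_prod_add (ht : 0 < t) : t ^ (n + 1) ≤ ∏ j ∈ Finset.range (n + 1), (t + j) := by
  rw [show t ^ (n + 1) = ∏ _j ∈ Finset.range (n + 1), t by simp]
  exact Finset.prod_le_prod (fun _ _ ↦ ht.le) fun j _ ↦ by simp

lemma brUnit_le (ht : 0 < t) : brUnit n t ≤ n.factorial / t ^ (n + 1) := by
  unfold brUnit
  gcongr
  exact pow_le_prod_add ht

lemma brUnit_pos (ht : 0 < t) : 0 < brUnit n t := by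
  unfold brUnit
  have : 0 < ∏ j ∈ Finset.range (n + 1), (t + j) := Finset.prod_pos fun j _ ↦ by positivity
  positivity

lemma add_one_add_le (hi : i < r) {k : ℕ} (hk : k ∈ Finset.range n) :
    (i * n + 1 + k : ℝ) ≤ r * n := by
  rw [Finset.mem_range] at hk
  have h : i * n + 1 + k ≤ r * n := by
    calc i * n + 1 + k ≤ (i + 1) * n := by rw [add_mul]; omega
      _ ≤ r * n := Nat.mul_le_mul_right _ hi
  exact_mod_cast h

lemma brLeft_nonneg (hi : i < r) (ht : r * n < t) : 0 ≤ brLeft n i t := by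
  have ht0 : 0 < t := lt_of_le_of_lt (by positivity) ht
  refine div_nonneg (Finset.prod_nonneg fun k hk ↦ ?_) (Finset.prod_nonneg fun j _ ↦ by positivity)
  linarith [add_one_add_le hi hk]

lemma brLeft_le (hi : i < r) (ht1 : 1 ≤ t) (ht : r * n < t) : brLeft n i t ≤ 1 := by
  have ht0 : 0 < t := by linarith
  refine div_le_one_of_le₀ ?_ (Finset.prod_nonneg fun j _ ↦ by positivity)
  refine le_trans ?_ (pow_le_prod_add ht0)
  calc _ ≤ ∏ _k ∈ Finset.range n, t := by
        refine Finset.prod_le_prod (fun k hk ↦ ?_) fun k _ ↦ ?_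
        · linarith [add_one_add_le hi hk]
        · have : (0 : ℝ) ≤ i * n + 1 + k := by positivity
          linarith
    _ = t ^ n := by simp
    _ ≤ t ^ (n + 1) := pow_le_pow_right₀ ht1 (Nat.le_succ n)

lemma brRight_nonneg (ht : 0 < t) : 0 ≤ brRight n i t :=
  div_nonneg (Finset.prod_nonneg fun k _ ↦ by positivity) (Finset.prod_nonneg fun j _ ↦ by positivity)

lemma brRight_le (hi : i < r) (ht1 : 1 ≤ t) (ht : r * n < t) : brRight n i t ≤ 3 ^ n := by
  have ht0 : 0 < t := by linarith
  have hr : (1 : ℝ) ≤ r := by exact_mod_cast (by omega : 1 ≤ r)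
  refine div_le_of_le_mul₀ (Finset.prod_nonneg fun j _ ↦ by positivity) (by positivity) ?_
  calc _ ≤ ∏ _k ∈ Finset.range n, (3 * t) := by
        refine Finset.prod_le_prod (fun k hk ↦ by positivity) fun k hk ↦ ?_
        have := add_one_add_le hi hk
        nlinarith [Nat.cast_nonneg (α := ℝ) n]
    _ = 3 ^ n * t ^ n := by simp [mul_pow]
    _ ≤ 3 ^ n * t ^ (n + 1) := by
        gcongr
        exact Nat.le_succ n
    _ ≤ _ := by
        gcongr
        exact pow_le_prod_add ht0

lemma brFun_nonneg {a : ℕ} (ht : r * n < t) : 0 ≤ brFun a r n t := by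
  have ht0 : 0 < t := lt_of_le_of_lt (by positivity) ht
  exact mul_nonneg (pow_nonneg (brUnit_pos ht0).le _) (Finset.prod_nonneg fun i hi ↦
    mul_nonneg (brLeft_nonneg (Finset.mem_range.1 hi) ht) (brRight_nonneg ht0))

lemma brFun_le {a : ℕ} (hr : 0 < r) (hn : 0 < n) (har : 2 * r + 2 ≤ a) (ht1 : 1 ≤ t)
    (ht : r * n < t) :
    brFun a r n t ≤
      (n.factorial / (n : ℝ) ^ n * (1 / (r : ℝ) ^ n)) ^ (a - 2 * r) * 3 ^ (n * r) * (1 / t ^ 2) := by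
  have ht0 : 0 < t := by linarith
  have h1 : brUnit n t ^ (a - 2 * r) ≤
      (n.factorial / (n : ℝ) ^ n * (1 / (r : ℝ) ^ n)) ^ (a - 2 * r) * (1 / t ^ 2) := by
    calc _ ≤ (n.factorial / (n : ℝ) ^ n * (1 / (r : ℝ) ^ n) * (1 / t)) ^ (a - 2 * r) := by
          refine pow_le_pow_left₀ (brUnit_pos ht0).le ((brUnit_le ht0).trans ?_) _
          have h2 : (n.factorial : ℝ) / (n : ℝ) ^ n * (1 / (r : ℝ) ^ n) * (1 / t) =
              n.factorial / ((r * n) ^ n * t) := by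
            rw [mul_pow]
            field_simp
          rw [h2, pow_succ]
          gcongr
      _ ≤ _ := by
          rw [mul_pow _ (1 / t), one_div_pow]
          gcongr
          omega
  have h2 : ∏ i ∈ Finset.range r, (brLeft n i t * brRight n i t) ≤ 3 ^ (n * r) := by
    calc _ ≤ ∏ _i ∈ Finset.range r, (3 : ℝ) ^ n := by
          refine Finset.prod_le_prod (fun i hi ↦ ?_) fun i hi ↦ ?_
          · exact mul_nonneg (brLeft_nonneg (Finset.mem_range.1 hi) ht) (brRight_nonneg ht0)
          · have hi' := Finset.mem_range.1 hi
            rw [← one_mul ((3 : ℝ) ^ n)]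
            exact mul_le_mul (brLeft_le hi' ht1 ht) (brRight_le hi' ht1 ht) (brRight_nonneg ht0)
              zero_le_one
      _ = _ := by simp [pow_mul]
  calc brFun a r n t ≤ ((n.factorial / (n : ℝ) ^ n * (1 / (r : ℝ) ^ n)) ^ (a - 2 * r) *
        (1 / t ^ 2)) * 3 ^ (n * r) := by
        refine mul_le_mul h1 h2 (Finset.prod_nonneg fun i hi ↦ ?_) (by positivity)
        exact mul_nonneg (brLeft_nonneg (Finset.mem_range.1 hi) ht) (brRight_nonneg ht0)
    _ = _ := by ring

/-- Lower bound for all factors at the first point where they do not vanish. -/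
lemma exp_neg_div_le (n r : ℕ) :
    Real.exp (-n) / ((r + 1) ^ (n + 1) * (Real.exp 1 * (n + 1))) ≤
      n.factorial / ∏ j ∈ Finset.range (n + 1), ((r * n + 1 : ℝ) + j) := by
  have h0 : 0 < ∏ j ∈ Finset.range (n + 1), ((r * n + 1 : ℝ) + j) :=
    Finset.prod_pos fun j _ ↦ by positivity
  have h1 : ∏ j ∈ Finset.range (n + 1), ((r * n + 1 : ℝ) + j) ≤ ((r + 1) * (n + 1)) ^ (n + 1) := by
    calc _ ≤ ∏ _j ∈ Finset.range (n + 1), ((r + 1) * (n + 1) : ℝ) := by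
          refine Finset.prod_le_prod (fun j _ ↦ by positivity) fun j hj ↦ ?_
          have : (j : ℝ) ≤ n := by
            rw [Finset.mem_range] at hj
            exact_mod_cast (by omega : j ≤ n)
          nlinarith [Nat.cast_nonneg (α := ℝ) r]
      _ = _ := by simp
  have h2 : (n : ℝ) ^ n / n.factorial ≤ Real.exp n :=
    Real.pow_div_factorial_le_exp _ (Nat.cast_nonneg n) n
  have h3 : ((n : ℝ) + 1) ^ n ≤ Real.exp 1 * n ^ n := by
    rcases Nat.eq_zero_or_pos n with rfl | hn
    · simp
    have hn' : (0 : ℝ) < n := by exact_mod_cast hn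
    have h4 := Real.add_one_le_exp (1 / (n : ℝ))
    calc ((n : ℝ) + 1) ^ n = ((1 / (n : ℝ) + 1) * n) ^ n := by
          congr 1
          field_simp
          ring
      _ ≤ (Real.exp (1 / n) * n) ^ n := by gcongr
      _ = _ := by
          rw [mul_pow, ← Real.exp_nat_mul, mul_one_div_cancel hn'.ne']
  rw [div_le_iff₀ (by positivity)] at h2
  rw [div_le_div_iff₀ (by positivity) h0]
  calc _ ≤ Real.exp (-n) * ((r + 1) * (n + 1)) ^ (n + 1) := by gcongr
    _ = Real.exp (-n) * ((r + 1) ^ (n + 1) * (n + 1)) * (n + 1) ^ n := by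
        rw [mul_pow, pow_succ ((n : ℝ) + 1)]
        ring
    _ ≤ Real.exp (-n) * ((r + 1) ^ (n + 1) * (n + 1)) *
        (Real.exp 1 * (Real.exp n * n.factorial)) := by
        gcongr
        exact h3.trans (by gcongr)
    _ = (Real.exp (-n) * Real.exp n) * (n.factorial * ((r + 1) ^ (n + 1) *
        (Real.exp 1 * (n + 1)))) := by ring
    _ = _ := by rw [← Real.exp_add]; simp

lemma le_brFun {a : ℕ} (har : 2 * r ≤ a) :
    (Real.exp (-n) / ((r + 1) ^ (n + 1) * (Real.exp 1 * (n + 1)))) ^ a ≤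
      brFun a r n (r * n + 1) := by
  set q := (n.factorial : ℝ) / ∏ j ∈ Finset.range (n + 1), ((r * n + 1 : ℝ) + j) with hq
  have h0 : 0 < ∏ j ∈ Finset.range (n + 1), ((r * n + 1 : ℝ) + j) :=
    Finset.prod_pos fun j _ ↦ by positivity
  have hq0 : 0 < q := by positivity
  have hfac : (n.factorial : ℝ) = ∏ k ∈ Finset.range n, ((k : ℝ) + 1) := by
    rw [← Finset.prod_range_add_one_eq_factorial]
    push_cast
    rfl
  have hL (i : ℕ) (hi : i < r) : q ≤ brLeft n i (r * n + 1) := by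
    rw [hq, brLeft]
    gcongr
    rw [hfac, ← Finset.prod_range_reflect]
    refine Finset.prod_le_prod (fun k _ ↦ by positivity) fun k hk ↦ ?_
    have hk' := Finset.mem_range.1 hk
    have h1 : (i + 1 : ℝ) * n ≤ r * n := by
      gcongr
      exact_mod_cast hi
    rw [Nat.sub_sub, Nat.cast_sub (by omega)]
    push_cast
    linarith
  have hR (i : ℕ) : q ≤ brRight n i (r * n + 1) := by
    rw [hq, brRight]
    gcongr
    rw [hfac]
    refine Finset.prod_le_prod (fun k _ ↦ by positivity) fun k hk ↦ ?_
    have : (0 : ℝ) ≤ r * n + n + i * n + 1 := by positivity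
    linarith
  calc _ ≤ q ^ a := pow_le_pow_left₀ (by positivity) (exp_neg_div_le n r) _
    _ = q ^ (a - 2 * r) * ∏ _i ∈ Finset.range r, (q * q) := by
        rw [Finset.prod_const, Finset.card_range, ← sq, ← pow_mul, ← pow_add,
          Nat.sub_add_cancel har]
    _ ≤ brFun a r n (r * n + 1) := by
        refine mul_le_mul_of_nonneg_left ?_ (by positivity)
        refine Finset.prod_le_prod (fun _ _ ↦ by positivity) fun i hi ↦ ?_
        have := hL i (Finset.mem_range.1 hi)
        exact mul_le_mul this (hR i) hq0.le (hq0.le.trans this)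

end bounds

lemma eventually_mul_pow_le_exp (C : ℝ) (k : ℕ) {δ : ℝ} (hδ : 0 < δ) :
    ∀ᶠ n : ℕ in atTop, C * (n : ℝ) ^ k ≤ Real.exp (δ * n) := by
  have h := ((isLittleO_pow_exp_pos_mul_atTop k hδ).comp_tendsto
    (tendsto_natCast_atTop_atTop (R := ℝ))).const_mul_left C
  filter_upwards [h.bound one_pos] with n hn
  simp only [Function.comp_apply, Real.norm_eq_abs, one_mul, Real.abs_exp] at hn
  exact (le_abs_self _).trans hn

lemma summable_one_div_add_one_sq : Summable fun k : ℕ ↦ 1 / ((k : ℝ) + 1) ^ 2 := by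
  exact_mod_cast (summable_nat_add_iff 1).2 (Real.summable_one_div_nat_pow.2 one_lt_two)

/-- Two-sided bounds for the sum of the Ball–Rivoal rational function over positive integers. -/
lemma brFun_sum_mem_Icc {a r n : ℕ} {S : ℝ} (hr : 0 < r) (hn : 0 < n) (har : 2 * r + 2 ≤ a)
    (hS : HasSum (fun k : ℕ ↦ brFun a r n (k + 1)) S) :
    S ∈ Set.Icc ((Real.exp (-n) / ((r + 1) ^ (n + 1) * (Real.exp 1 * (n + 1)))) ^ a)
      ((n.factorial / (n : ℝ) ^ n * (1 / (r : ℝ) ^ n)) ^ (a - 2 * r) * 3 ^ (n * r) * zetaR 2) := by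
  have hlt {k : ℕ} (hk : r * n ≤ k) : (r * n : ℝ) < k + 1 := by
    exact_mod_cast Nat.lt_succ_of_le hk
  have hnonneg (k : ℕ) : 0 ≤ brFun a r n (k + 1) := by
    rcases lt_or_ge k (r * n) with hk | hk
    · exact (brFun_eq_zero hk).ge
    · exact brFun_nonneg (hlt hk)
  constructor
  · refine (le_brFun (by omega)).trans ?_
    simpa using le_hasSum hS (r * n) fun k _ ↦ hnonneg k
  · refine hasSum_le (fun k ↦ ?_) hS (summable_one_div_add_one_sq.hasSum.mul_left _)
    rcases lt_or_ge k (r * n) with hk | hk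
    · rw [brFun_eq_zero hk]
      positivity
    · exact brFun_le hr hn har (by simp) (hlt hk)

lemma exp_mul_log {x : ℝ} (hx : 0 < x) (n : ℕ) : Real.exp (n * Real.log x) = x ^ n := by
  rw [Real.exp_nat_mul, Real.exp_log hx]

section exponents

variable {a r : ℕ} {δ : ℝ}

lemma eventually_exp_le_lower (hδ : 0 < δ) :
    ∀ᶠ n : ℕ in atTop, Real.exp (-(a * (1 + Real.log (r + 1)) + δ) * n) ≤
      (Real.exp (-n) / ((r + 1) ^ (n + 1) * (Real.exp 1 * (n + 1)))) ^ a := by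
  filter_upwards [eventually_mul_pow_le_exp ((2 * (r + 1) * Real.exp 1) ^ a) a hδ,
    eventually_ge_atTop 1] with n hn hn1
  have hn1' : (1 : ℝ) ≤ n := by exact_mod_cast hn1
  have h1 : ((r + 1 : ℝ) ^ (n + 1) * (Real.exp 1 * (n + 1))) ^ a ≤
      ((r + 1 : ℝ) ^ n) ^ a * Real.exp (δ * n) := by
    calc _ ≤ ((r + 1 : ℝ) ^ (n + 1) * (Real.exp 1 * (n + n))) ^ a := by gcongr
      _ = ((r + 1 : ℝ) ^ n) ^ a * ((2 * (r + 1) * Real.exp 1) ^ a * n ^ a) := by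
        rw [← mul_pow, ← mul_pow]
        congr 1
        ring
      _ ≤ _ := by gcongr
  have h2 : Real.exp (-(a * (1 + Real.log (r + 1)) + δ) * n) =
      Real.exp (-n) ^ a / (((r + 1 : ℝ) ^ n) ^ a * Real.exp (δ * n)) := by
    rw [eq_div_iff (by positivity), ← exp_mul_log (x := (r + 1 : ℝ)) (by positivity), ← Real.exp_nat_mul,
      ← Real.exp_nat_mul, ← Real.exp_add, ← Real.exp_add]
    ring_nf
  rw [h2, div_pow]
  gcongr

lemma eventually_upper_le_exp (hr : 0 < r) (har : 2 * r ≤ a) (hδ : 0 < δ) (C : ℝ) (hC : 0 ≤ C) :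
    ∀ᶠ n : ℕ in atTop,
      C * ((n.factorial / (n : ℝ) ^ n * (1 / (r : ℝ) ^ n)) ^ (a - 2 * r) * 3 ^ (n * r)) ≤
        Real.exp (-((a - 2 * r) * (1 + Real.log r) - r * Real.log 3 - δ) * n) := by
  filter_upwards [eventually_mul_pow_le_exp (C * Real.exp 1 ^ (a - 2 * r)) (a - 2 * r) hδ,
    eventually_ge_atTop 1] with n hn hn1
  calc _ ≤ C * ((Real.exp 1 * n * Real.exp (-n) * (1 / (r : ℝ) ^ n)) ^ (a - 2 * r) *
        3 ^ (n * r)) := by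
        gcongr
        exact factorial_div_pow_le hn1
    _ = C * Real.exp 1 ^ (a - 2 * r) * n ^ (a - 2 * r) *
        ((Real.exp (-n) * (1 / (r : ℝ) ^ n)) ^ (a - 2 * r) * 3 ^ (n * r)) := by
        simp only [mul_pow]
        ring
    _ ≤ Real.exp (δ * n) * ((Real.exp (-n) * (1 / (r : ℝ) ^ n)) ^ (a - 2 * r) *
        3 ^ (n * r)) := by gcongr
    _ = _ := by
        have h1 : 1 / (r : ℝ) ^ n = Real.exp (-(n * Real.log r)) := by
          rw [Real.exp_neg, exp_mul_log (by exact_mod_cast hr), one_div]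
        rw [h1, ← exp_mul_log (x := 3) (by norm_num), ← Real.exp_add, ← Real.exp_nat_mul,
          ← Real.exp_add, ← Real.exp_add, Nat.cast_sub har]
        push_cast
        ring_nf

lemma eventually_coeff_le_exp (hδ : 0 < δ) :
    ∀ᶠ n : ℕ in atTop,
      2 * (a.factorial * (((2 : ℝ) ^ n) ^ a * ((3 * (r + 1)) ^ n) ^ (2 * r))) ≤
        Real.exp ((a * Real.log 2 + 2 * r * Real.log (3 * (r + 1)) + δ) * n) := by
  filter_upwards [eventually_mul_pow_le_exp (2 * a.factorial) 0 hδ] with n hn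
  rw [pow_zero, mul_one] at hn
  calc _ = (2 * a.factorial) * (((2 : ℝ) ^ n) ^ a * ((3 * (r + 1)) ^ n) ^ (2 * r)) := by ring
    _ ≤ Real.exp (δ * n) * (((2 : ℝ) ^ n) ^ a * ((3 * (r + 1)) ^ n) ^ (2 * r)) := by gcongr
    _ = _ := by
        rw [← exp_mul_log (x := 2) (by norm_num), ← exp_mul_log (x := 3 * (r + 1 : ℝ))
          (by positivity), ← Real.exp_nat_mul, ← Real.exp_nat_mul, ← Real.exp_add,
          ← Real.exp_add]
        push_cast
        ring_nf

end exponents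

lemma exists_nat_mul_mem_Icc {L E : ℝ} (hL : 0 < L) (hLE : L ≤ E) :
    ∃ m : ℕ, E / 2 ≤ m * L ∧ m * L ≤ E := by
  refine ⟨⌊E / L⌋₊, ?_, ?_⟩
  · have h1 : (1 : ℝ) ≤ ⌊E / L⌋₊ := by
      exact_mod_cast (Nat.one_le_floor_iff _).2 ((one_le_div hL).2 hLE)
    have h2 := Nat.lt_floor_add_one (E / L)
    rw [div_lt_iff₀ hL] at h2
    nlinarith
  · rw [← le_div_iff₀ hL]
    exact Nat.floor_le (div_nonneg (hL.le.trans hLE) hL.le)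

/-- Integer linear forms in `1` and odd zeta values up to `a`, normalized so that their size and
the size of their coefficients is controlled by explicit exponentials. -/
lemma eventually_exists_linear_form {a r : ℕ} {δ : ℝ} (ha : Odd a) (hr : 0 < r)
    (har : 2 * r + 2 ≤ a) (hδ : 0 < δ) :
    ∀ᶠ n : ℕ in atTop, Even n → ∃ (p₀ : ℤ) (p : ℕ → ℤ),
      Real.exp (-(a * (1 + Real.log (r + 1)) - (1 + δ) * a + δ) * n) ≤
        |p₀ + ∑ l ∈ Finset.range a with Even l ∧ l ≠ 0, p l * zetaR (l + 1)| ∧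
      |p₀ + ∑ l ∈ Finset.range a with Even l ∧ l ≠ 0, p l * zetaR (l + 1)| ≤
        Real.exp (-((a - 2 * r) * (1 + Real.log r) - r * Real.log 3 - (1 + δ) * a - δ) * n) ∧
      ∀ l < a, |(p l : ℝ)| ≤
        Real.exp (((1 + δ) * a + a * Real.log 2 + 2 * r * Real.log (3 * (r + 1)) + δ) * n) := by
  have hz : 0 ≤ zetaR 2 := tsum_nonneg fun k ↦ by positivity
  filter_upwards [eventually_lcmUpto_le hδ, eventually_exp_le_lower (a := a) (r := r) hδ,
    eventually_upper_le_exp hr (by omega : 2 * r ≤ a) hδ (2 * zetaR 2) (by positivity),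
    eventually_coeff_le_exp (a := a) (r := r) hδ, eventually_ge_atTop 1]
    with n hlcm hlow hup hco hn1 hne
  obtain ⟨p₀, p, hsum, hp⟩ := exists_linear_form_brFun (r := r) ha (by omega) hr hne
  have hL : 0 < (Nat.lcmUpto n : ℝ) ^ a := by
    have : (0 : ℝ) < Nat.lcmUpto n := by exact_mod_cast Nat.lcmUpto_pos n
    positivity
  have hLE : (Nat.lcmUpto n : ℝ) ^ a ≤ Real.exp ((1 + δ) * a * n) := by
    calc _ ≤ Real.exp ((1 + δ) * n) ^ a := by gcongr
      _ = _ := by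
        rw [← Real.exp_nat_mul]
        ring_nf
  obtain ⟨m, hm1, hm2⟩ := exists_nat_mul_mem_Icc hL hLE
  set L := (Nat.lcmUpto n : ℝ) ^ a
  set E := Real.exp ((1 + δ) * a * n) with hE
  set T := (p₀ + ∑ l ∈ Finset.range a with Even l ∧ l ≠ 0, p l * zetaR (l + 1) : ℝ) with hT
  have hsum' : HasSum (fun k : ℕ ↦ brFun a r n (k + 1)) (T / (L * 2)) := by
    have h : (fun k : ℕ ↦ brFun a r n (k + 1)) =
        fun k : ℕ ↦ L * (2 * brFun a r n (k + 1)) / (L * 2) := by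
      funext k
      rw [← mul_assoc, mul_div_cancel_left₀ _ (by positivity)]
    rw [h]
    exact hsum.div_const (L * 2)
  obtain ⟨hS1, hS2⟩ := brFun_sum_mem_Icc hr hn1 har hsum'
  set S := T / (L * 2) with hS
  have hTS : T = L * 2 * S := by
    rw [hS]
    field_simp
  have hS0 : 0 ≤ S := le_trans (by positivity) hS1
  have hval : ((m * p₀ : ℤ) : ℝ) + ∑ l ∈ Finset.range a with Even l ∧ l ≠ 0,
      ((m * p l : ℤ) : ℝ) * zetaR (l + 1) = m * L * (2 * S) := by
    rw [mul_assoc, ← mul_assoc L, ← hTS, hT, mul_add, Finset.mul_sum]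
    push_cast
    simp only [mul_assoc]
  refine ⟨m * p₀, fun l ↦ m * p l, ?_, ?_, fun l hl ↦ ?_⟩
  · rw [hval, abs_of_nonneg (by positivity)]
    calc _ = E * Real.exp (-(a * (1 + Real.log (r + 1)) + δ) * n) := by
          rw [hE, ← Real.exp_add]
          ring_nf
      _ ≤ E * S := by
          gcongr
          exact hlow.trans hS1
      _ = E / 2 * (2 * S) := by ring
      _ ≤ _ := by gcongr
  · rw [hval, abs_of_nonneg (by positivity)]
    calc _ ≤ E * (2 * S) := by gcongr
      _ ≤ E * Real.exp (-((a - 2 * r) * (1 + Real.log r) - r * Real.log 3 - δ) * n) := by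
          gcongr
          linarith
      _ = _ := by
          rw [hE, ← Real.exp_add]
          ring_nf
  · push_cast
    rw [abs_mul, Nat.abs_cast]
    calc _ ≤ m * (L * (2 * (a.factorial * ((2 ^ n) ^ a * ((3 * (r + 1)) ^ n) ^ (2 * r))))) := by
          gcongr
          exact hp l hl
      _ = m * L * (2 * (a.factorial * ((2 ^ n) ^ a * ((3 * (r + 1)) ^ n) ^ (2 * r)))) := by ring
      _ ≤ E * Real.exp ((a * Real.log 2 + 2 * r * Real.log (3 * (r + 1)) + δ) * n) := by gcongr
      _ = _ := by
          rw [hE, ← Real.exp_add]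
          ring_nf

/-- The quantitative bound obtained from Nesterenko's criterion for fixed parameters `a`, `r`. -/
lemma deltaDim_lower_bound {a r : ℕ} {δ α₁ α₂ β : ℝ} (ha : Odd a) (hr : 0 < r)
    (har : 2 * r + 2 ≤ a) (hδ : 0 < δ)
    (hα₁ : α₁ = (a - 2 * r) * (1 + Real.log r) - r * Real.log 3 - (1 + δ) * a - δ)
    (hα₂ : α₂ = a * (1 + Real.log (r + 1)) - (1 + δ) * a + δ)
    (hβ : β = (1 + δ) * a + a * Real.log 2 + 2 * r * Real.log (3 * (r + 1)) + δ)
    (hpos : 0 < α₁) : α₁ ≤ (deltaDim a - 1) * (β + α₂ - α₁) := by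
  have hform := eventually_exists_linear_form ha hr har hδ
  rw [← hα₁, ← hα₂, ← hβ] at hform
  set I := Finset.range a |>.filter fun l ↦ Even l ∧ l ≠ 0 with hI
  have hform' : ∀ m : ℕ, ∃ q : ℤ × (ℕ → ℤ), (∃ (p₀ : ℤ) (p : ℕ → ℤ),
      Real.exp (-α₂ * (2 * m : ℕ)) ≤ |p₀ + ∑ l ∈ I, p l * zetaR (l + 1)| ∧
      |p₀ + ∑ l ∈ I, p l * zetaR (l + 1)| ≤ Real.exp (-α₁ * (2 * m : ℕ)) ∧
      ∀ l < a, |(p l : ℝ)| ≤ Real.exp (β * (2 * m : ℕ))) →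
      Real.exp (-α₂ * (2 * m : ℕ)) ≤ |q.1 + ∑ l ∈ I, q.2 l * zetaR (l + 1)| ∧
      |q.1 + ∑ l ∈ I, q.2 l * zetaR (l + 1)| ≤ Real.exp (-α₁ * (2 * m : ℕ)) ∧
      ∀ l < a, |(q.2 l : ℝ)| ≤ Real.exp (β * (2 * m : ℕ)) := by
    intro m
    by_cases h : ∃ (p₀ : ℤ) (p : ℕ → ℤ),
        Real.exp (-α₂ * (2 * m : ℕ)) ≤ |p₀ + ∑ l ∈ I, p l * zetaR (l + 1)| ∧
        |p₀ + ∑ l ∈ I, p l * zetaR (l + 1)| ≤ Real.exp (-α₁ * (2 * m : ℕ)) ∧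
        ∀ l < a, |(p l : ℝ)| ≤ Real.exp (β * (2 * m : ℕ))
    · obtain ⟨p₀, p, h⟩ := h
      exact ⟨(p₀, p), fun _ ↦ h⟩
    · exact ⟨(0, 0), fun h' ↦ absurd h' h⟩
  choose q hq using hform'
  have hev : ∀ᶠ m : ℕ in atTop,
      Real.exp (-α₂ * (2 * m : ℕ)) ≤ |(q m).1 + ∑ l ∈ I, (q m).2 l * zetaR (l + 1)| ∧
      |(q m).1 + ∑ l ∈ I, (q m).2 l * zetaR (l + 1)| ≤ Real.exp (-α₁ * (2 * m : ℕ)) ∧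
      ∀ l < a, |((q m).2 l : ℝ)| ≤ Real.exp (β * (2 * m : ℕ)) := by
    have htend : Tendsto (fun m : ℕ ↦ 2 * m) atTop atTop :=
      tendsto_id.const_mul_atTop' two_pos
    filter_upwards [htend.eventually hform] with m hm
    exact hq m (hm (even_two_mul m))
  have hle : α₁ ≤ α₂ := by
    obtain ⟨m, ⟨h1, h2, -⟩, hm⟩ := (hev.and (eventually_ge_atTop 1)).exists
    have h3 := Real.exp_le_exp.1 (h1.trans h2)
    have : (0 : ℝ) < (2 * m : ℕ) := by exact_mod_cast (by omega : 0 < 2 * m)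
    nlinarith
  have hsumI (m : ℕ) : ∑ l : I, ((q m).2 l : ℝ) * zetaR (l + 1) =
      ∑ l ∈ I, (q m).2 l * zetaR (l + 1) :=
    Finset.sum_coe_sort I fun l ↦ ((q m).2 l : ℝ) * zetaR (l + 1)
  have hcast (x : ℝ) (m : ℕ) : x * (2 * m : ℕ) = 2 * x * m := by
    push_cast
    ring
  have key := nesterenko_finrank (fun l : I ↦ zetaR (l + 1)) (fun m ↦ (q m).1)
    (fun m l ↦ (q m).2 l) (a₁ := 2 * α₁) (a₂ := 2 * α₂) (b := 2 * β) (by linarith) (by linarith)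
    (by
      filter_upwards [hev] with m hm
      rw [hsumI, ← mul_neg, ← hcast]
      exact hm.1)
    (by
      filter_upwards [hev] with m hm
      rw [hsumI, ← mul_neg, ← hcast]
      exact hm.2.1)
    (by
      filter_upwards [hev] with m hm
      intro l
      rw [← hcast]
      exact hm.2.2 l (Finset.mem_range.1 (Finset.mem_filter.1 l.2).1))
  have hset : Set.range (fun l : I ↦ zetaR (l + 1)) =
      {x : ℝ | ∃ s : ℕ, Odd s ∧ 3 ≤ s ∧ s ≤ a ∧ x = zetaR s} := by
    ext x
    simp only [Set.mem_range, Set.mem_ofPred_eq, Subtype.exists, hI, Finset.mem_filter,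
      Finset.mem_range]
    constructor
    · rintro ⟨l, ⟨hl, hle, hl0⟩, rfl⟩
      obtain ⟨c, rfl⟩ := hle
      exact ⟨c + c + 1, ⟨c, by ring⟩, by omega, by omega, rfl⟩
    · rintro ⟨s, ⟨c, rfl⟩, h3, hsa, rfl⟩
      exact ⟨2 * c, ⟨by omega, even_two_mul c, by omega⟩, rfl⟩
  rw [hset] at key
  change 2 * α₁ ≤ ((deltaDim a : ℝ) - 1) * _ at key
  linarith

/-- A parameter `r` of size about `a ^ (1 - δ)`. -/
lemma eventually_exists_param {δ : ℝ} (hδ : 0 < δ) (hδ1 : δ < 1) :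
    ∀ᶠ a : ℕ in atTop, ∃ r : ℕ, 0 < r ∧ 4 ≤ δ * r ∧ 32 * (r * Real.log a) ≤ δ * a ∧
      (1 - δ) * Real.log a - Real.log 2 ≤ Real.log r := by
  have hcast := tendsto_natCast_atTop_atTop (R := ℝ)
  have hx := (tendsto_rpow_atTop (sub_pos.2 hδ1)).comp hcast
  have hlog := (isLittleO_log_rpow_atTop hδ).bound (c := δ / 32) (by positivity)
  filter_upwards [hcast.eventually hlog, hx.eventually_ge_atTop (4 / δ + 1),
    eventually_ge_atTop 1] with a h1 h2 ha
  simp only [Function.comp_apply] at h2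
  have ha' : (1 : ℝ) ≤ a := by exact_mod_cast ha
  have ha0 : (0 : ℝ) < a := by linarith
  have hΛ := Real.log_nonneg ha'
  rw [Real.norm_of_nonneg hΛ, Real.norm_of_nonneg (by positivity)] at h1
  set x := (a : ℝ) ^ (1 - δ) with hxdef
  have hx0 : 0 < x := by positivity
  have hprod : x * (a : ℝ) ^ δ = a := by
    rw [hxdef, ← Real.rpow_add ha0, sub_add_cancel, Real.rpow_one]
  have hfl := Nat.floor_le hx0.le
  have hlt := Nat.lt_floor_add_one x
  have h4 : 4 / δ ≤ (⌊x⌋₊ : ℝ) := by linarith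
  have h4' : 4 ≤ δ * (⌊x⌋₊ : ℝ) := by rwa [div_le_iff₀' hδ] at h4
  have hr1 : (1 : ℝ) ≤ ⌊x⌋₊ := by nlinarith
  refine ⟨⌊x⌋₊, by exact_mod_cast hr1, h4', ?_, ?_⟩
  · calc _ ≤ 32 * (x * (δ / 32 * (a : ℝ) ^ δ)) := by gcongr
      _ = δ * (x * (a : ℝ) ^ δ) := by ring
      _ = _ := by rw [hprod]
  · rw [← Real.log_rpow ha0, ← hxdef, ← Real.log_div hx0.ne' two_ne_zero]
    apply Real.log_le_log (by positivity)
    linarith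

lemma log_add_one_sub_log_le {x : ℝ} (hx : 0 < x) : Real.log (x + 1) - Real.log x ≤ 1 / x := by
  rw [← Real.log_div (by positivity) hx.ne']
  refine (Real.log_le_sub_one_of_pos (by positivity)).trans_eq ?_
  field_simp
  ring

lemma eventually_le_deltaDim {δ : ℝ} (hδ : 0 < δ) (hδ1 : δ < 1 / 4) :
    ∀ᶠ a : ℕ in atTop, Odd a →
      (1 - 2 * δ) * Real.log a ≤ (deltaDim a - 1) * (1 + Real.log 2 + 2 * δ) := by
  have hlog := Real.tendsto_log_atTop.comp (tendsto_natCast_atTop_atTop (R := ℝ))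
  filter_upwards [eventually_exists_param hδ (by linarith), eventually_ge_atTop 12,
    hlog.eventually_ge_atTop (3 / δ)] with a hr ha hΛ hodd
  obtain ⟨r, hr0, hδr, hrΛ, hlogr⟩ := hr
  rw [Function.comp_apply, div_le_iff₀' hδ] at hΛ
  have ha' : (12 : ℝ) ≤ a := by exact_mod_cast ha
  have hr' : (1 : ℝ) ≤ r := by exact_mod_cast hr0
  set Λ := Real.log a with hΛdef
  have hΛ12 : 12 ≤ Λ := by
    by_contra! h
    nlinarith
  have hr12 : (r : ℝ) * 12 ≤ r * Λ := by gcongr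
  have hδa : δ * a ≤ a / 4 := by nlinarith
  have h3r : 3 * ((r : ℝ) + 1) ≤ a := by linarith
  have hl2 : Real.log 2 ≤ 1 := by linarith [Real.log_two_lt_d9]
  have hl2' : 0 < Real.log 2 := Real.log_pos one_lt_two
  have hl3 : Real.log 3 ≤ 2 := by
    linarith [Real.log_le_sub_one_of_pos (show (0 : ℝ) < 3 by norm_num)]
  have hl3' : 0 < Real.log 3 := Real.log_pos (by norm_num)
  have hlr0 : 0 ≤ Real.log r := Real.log_nonneg hr'
  have hlr : Real.log r ≤ Λ := Real.log_le_log (by positivity) (by linarith)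
  have hl3r : Real.log (3 * (r + 1)) ≤ Λ := Real.log_le_log (by positivity) h3r
  have hl3r' : 0 ≤ Real.log (3 * (r + 1)) := Real.log_nonneg (by linarith)
  have hdiff := log_add_one_sub_log_le (show (0 : ℝ) < r by linarith)
  have hdiff' : Real.log r ≤ Real.log (r + 1) := Real.log_le_log (by positivity) (by linarith)
  have hinv : 1 / (r : ℝ) ≤ δ / 4 := by
    rw [div_le_div_iff₀ (by positivity) (by norm_num)]
    linarith
  have e1 : (r : ℝ) * Real.log r ≤ r * Λ := by gcongr
  have e2 : (r : ℝ) * Real.log (3 * (r + 1)) ≤ r * Λ := by gcongr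
  have e3 : (r : ℝ) * Real.log 3 ≤ r * 2 := by gcongr
  have e4 : (a : ℝ) * (Real.log (r + 1) - Real.log r) ≤ a * (δ / 4) := by
    gcongr
    exact hdiff.trans hinv
  have e5 : (a : ℝ) * ((1 - δ) * Λ - Real.log 2) ≤ a * Real.log r := by gcongr
  have e6 : (a : ℝ) * 3 ≤ a * (δ * Λ) := by gcongr
  have e7 : (a : ℝ) * Real.log 2 ≤ a * 1 := by gcongr
  have e8 : 12 * δ ≤ δ * a := by nlinarith
  have n1 : 0 ≤ (r : ℝ) * Real.log r := by positivity
  have n2 : 0 ≤ (r : ℝ) * Real.log (3 * (r + 1)) := by positivity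
  have n3 : 0 ≤ (r : ℝ) * Real.log 3 := by positivity
  have n4 : 0 ≤ (a : ℝ) * (Real.log (r + 1) - Real.log r) :=
    mul_nonneg (by positivity) (sub_nonneg.2 hdiff')
  have n5 : 0 < (a : ℝ) * Real.log 2 := by positivity
  set α₁ := (a - 2 * r) * (1 + Real.log r) - r * Real.log 3 - (1 + δ) * a - δ with hα₁
  set α₂ := a * (1 + Real.log (r + 1)) - (1 + δ) * a + δ with hα₂
  set β := (1 + δ) * a + a * Real.log 2 + 2 * r * Real.log (3 * (r + 1)) + δ with hβ
  have hα₁low : a * ((1 - 2 * δ) * Λ) ≤ α₁ := by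
    rw [hα₁]
    nlinarith
  have hα₁pos : 0 < α₁ := lt_of_lt_of_le (by
    have : 0 < 1 - 2 * δ := by linarith
    positivity) hα₁low
  have hDen : β + α₂ - α₁ = a * (1 + Real.log 2 + δ) + a * (Real.log (r + 1) - Real.log r) +
      2 * (r * Real.log (3 * (r + 1))) + 3 * δ + 2 * r + 2 * (r * Real.log r) +
      r * Real.log 3 := by
    rw [hα₁, hα₂, hβ]
    ring
  have hDen0 : 0 ≤ β + α₂ - α₁ := by
    rw [hDen]
    positivity
  have hDenle : β + α₂ - α₁ ≤ a * (1 + Real.log 2 + 2 * δ) := by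
    rw [hDen]
    linarith
  have har : 2 * r + 2 ≤ a := by
    have : (2 * r + 2 : ℝ) ≤ a := by linarith
    exact_mod_cast this
  have key := deltaDim_lower_bound hodd hr0 har hδ hα₁ hα₂ hβ hα₁pos
  have hd : (0 : ℝ) ≤ deltaDim a - 1 := by
    by_contra! h
    nlinarith [mul_nonneg (neg_nonneg.2 h.le) hDen0]
  refine le_of_mul_le_mul_left ?_ (show (0 : ℝ) < a by linarith)
  calc _ ≤ (deltaDim a - 1) * (β + α₂ - α₁) := hα₁low.trans key
    _ ≤ (deltaDim a - 1) * (a * (1 + Real.log 2 + 2 * δ)) := by gcongr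
    _ = _ := by ring

/-- (Ball–Rivoal) For every `ε > 0` there is `ℓ₀` such that for every odd
`ℓ ≥ ℓ₀` one has `δ_ℓ ≥ (1-ε)/(1+log 2) · log ℓ`. -/
theorem ball_rivoal_log_lower_bound (ε : ℝ) (hε : 0 < ε) :
    ∃ ℓ₀ : ℕ, ∀ ℓ : ℕ, ℓ₀ ≤ ℓ → Odd ℓ →
      (1 - ε) / (1 + Real.log 2) * Real.log ℓ ≤ (deltaDim ℓ : ℝ) := by
  have hl2 : 0 < Real.log 2 := Real.log_pos one_lt_two
  rcases le_or_gt 1 ε with h1 | h1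
  · refine ⟨0, fun ℓ _ _ ↦ le_trans ?_ (Nat.cast_nonneg _)⟩
    exact mul_nonpos_of_nonpos_of_nonneg
      (div_nonpos_of_nonpos_of_nonneg (by linarith) (by positivity)) (Real.log_natCast_nonneg _)
  · obtain ⟨ℓ₀, hℓ₀⟩ := eventually_atTop.1
      (eventually_le_deltaDim (δ := ε / 4) (by positivity) (by linarith))
    refine ⟨ℓ₀, fun ℓ hℓ hodd ↦ ?_⟩
    have h := hℓ₀ ℓ hℓ hodd
    have hΛ := Real.log_natCast_nonneg ℓ
    rw [div_mul_eq_mul_div, div_le_iff₀ (by positivity)]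
    rw [← div_le_iff₀ (by positivity)] at h
    have h2 : (1 - ε) / (1 + Real.log 2) ≤
        (1 - 2 * (ε / 4)) / (1 + Real.log 2 + 2 * (ε / 4)) := by
      rw [div_le_div_iff₀ (by positivity) (by positivity)]
      nlinarith [mul_pos hε hl2]
    have h3 := mul_le_mul_of_nonneg_right h2 hΛ
    rw [div_mul_eq_mul_div, div_mul_eq_mul_div] at h3
    rw [← div_le_iff₀ (by positivity)]
    linarith
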